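/- arXiv:1012.1573 — 5 statements merged into one kernel-verified Lean document; each statement's English description precedes it below -/
import Mathlib

section
/- For every n ≥ 1, the number of distinct unique-sink orientations of the n-cube that arise as the orientation induced by LCP(M,q) for some n×n P-matrix M and some nondegenerate vector q ∈ ℝ^n (the P-USOs) is at most (4e·2^n)^{n²+n}; in particular, the number of n-dimensional P-USOs is 2^{O(n³)}. -/
open Matrix BigOperators

/-- A vertex of the `n`-cube: a bit vector of length `n`. -/
abbrev Vertex (n : ℕ) := Fin n → Bool

/-- An orientation of the `n`-cube, given by its "out-map":
`φ v i = true` means that the edge `{v, v ⊕ i}` is directed from `v` to `v ⊕ i`. -/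
abbrev CubeOrientation (n : ℕ) := Vertex n → Fin n → Bool

/-- `v ⊕ i`: flip the `i`-th bit of `v`. -/
def vflip {n : ℕ} (v : Vertex n) (i : Fin n) : Vertex n :=
  Function.update v i (!(v i))

/-- `u` belongs to the subcube with base vertex `v` and coordinate set `C`. -/
def InSubcube {n : ℕ} (v : Vertex n) (C : Finset (Fin n)) (u : Vertex n) : Prop :=
  ∀ j, j ∉ C → u j = v j

/-- `u` is a sink of the subcube `(v, C)`: all subcube edges at `u` are incoming. -/
def IsSink {n : ℕ} (φ : CubeOrientation n) (v : Vertex n) (C : Finset (Fin n))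
    (u : Vertex n) : Prop :=
  InSubcube v C u ∧ ∀ i ∈ C, φ u i = false

/-- `u` is a source of the subcube `(v, C)`: all subcube edges at `u` are outgoing. -/
def IsSource {n : ℕ} (φ : CubeOrientation n) (v : Vertex n) (C : Finset (Fin n))
    (u : Vertex n) : Prop :=
  InSubcube v C u ∧ ∀ i ∈ C, φ u i = true

/-- Unique-sink orientation: every subcube has a unique sink. -/
def IsUSO {n : ℕ} (φ : CubeOrientation n) : Prop :=
  ∀ (v : Vertex n) (C : Finset (Fin n)), ∃! u, IsSink φ v C u

/-- One directed step along an edge of the orientation. -/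
def OrientStep {n : ℕ} (φ : CubeOrientation n) (u w : Vertex n) : Prop :=
  ∃ i, φ u i = true ∧ w = vflip u i

/-- Acyclicity: no directed cycle. -/
def IsAcyclic {n : ℕ} (φ : CubeOrientation n) : Prop :=
  ∀ u, ¬ Relation.TransGen (OrientStep φ) u u

/-- Local uniformity of an orientation. -/
def LocallyUniform {n : ℕ} (φ : CubeOrientation n) : Prop :=
  (∀ (u : Vertex n) (i j : Fin n), i ≠ j → u i = false → u j = false →
      φ u i = true → φ u j = true →
      φ (vflip u i) j = true ∧ φ (vflip u j) i = true) ∧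
  (∀ (u : Vertex n) (i j : Fin n), i ≠ j → u i = false → u j = false →
      φ (vflip u i) i = true → φ (vflip u j) j = true →
      φ (vflip (vflip u i) j) j = true ∧ φ (vflip (vflip u j) i) i = true)

/-- `p` is a directed path from `s` to `t` inside the subcube `(v, C)`. -/
def IsDirPathIn {n : ℕ} (φ : CubeOrientation n) (v : Vertex n) (C : Finset (Fin n))
    (s t : Vertex n) (p : List (Vertex n)) : Prop :=
  p.head? = some s ∧ p.getLast? = some t ∧ p.Nodup ∧
  (∀ u ∈ p, InSubcube v C u) ∧
  p.Chain' (fun a b => ∃ i ∈ C, φ a i = true ∧ b = vflip a i)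

/-- The Holt–Klee property: in every subcube of dimension `d`, there are `d` directed
paths from the source to the sink, pairwise sharing no vertex besides source and sink. -/
def HoltKlee {n : ℕ} (φ : CubeOrientation n) : Prop :=
  IsUSO φ ∧
  ∀ (v : Vertex n) (C : Finset (Fin n)) (s t : Vertex n),
    IsSource φ v C s → IsSink φ v C t →
    ∃ P : Fin C.card → List (Vertex n),
      (∀ k, IsDirPathIn φ v C s t (P k)) ∧
      ∀ k l, k ≠ l → ∀ u, u ∈ P k → u ∈ P l → u = s ∨ u = t

/-- `φ^{(F)}`: reverse all edges in the coordinates belonging to `F`. -/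
def Reorient {n : ℕ} (φ : CubeOrientation n) (F : Finset (Fin n)) : CubeOrientation n :=
  fun v i => if i ∈ F then φ (vflip v i) i else φ v i

/-- Strong Holt–Klee property. -/
def StronglyHoltKlee {n : ℕ} (φ : CubeOrientation n) : Prop :=
  ∀ F : Finset (Fin n), HoltKlee (Reorient φ F)

/-- A P-matrix: all principal minors are positive. -/
def IsPMatrix {n : ℕ} (M : Matrix (Fin n) (Fin n) ℝ) : Prop :=
  ∀ S : Finset (Fin n), S.Nonempty →
    0 < (M.submatrix (fun i : S => (i : Fin n)) (fun i : S => (i : Fin n))).det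

/-- A Z-matrix: all off-diagonal entries are non-positive. -/
def IsZMatrix {n : ℕ} (M : Matrix (Fin n) (Fin n) ℝ) : Prop :=
  ∀ i j, i ≠ j → M i j ≤ 0

/-- A K-matrix: both a Z-matrix and a P-matrix. -/
def IsKMatrix {n : ℕ} (M : Matrix (Fin n) (Fin n) ℝ) : Prop :=
  IsZMatrix M ∧ IsPMatrix M

/-- The matrix `A_B`: its `s`-th column is the `s`-th column of `-M` if `s ∈ B`,
and the `s`-th column of the identity matrix otherwise. -/
def ABmat {n : ℕ} (M : Matrix (Fin n) (Fin n) ℝ) (B : Finset (Fin n)) :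
    Matrix (Fin n) (Fin n) ℝ :=
  fun r s => if s ∈ B then -(M r s) else if r = s then 1 else 0

/-- The vector `A_B⁻¹ q`. -/
noncomputable def lcpVal {n : ℕ} (M : Matrix (Fin n) (Fin n) ℝ) (q : Fin n → ℝ)
    (B : Finset (Fin n)) : Fin n → ℝ :=
  (ABmat M B)⁻¹ *ᵥ q

/-- `q` is nondegenerate for `M`: `(A_B⁻¹ q)_i ≠ 0` for all `B` and `i`. -/
def Nondegenerate {n : ℕ} (M : Matrix (Fin n) (Fin n) ℝ) (q : Fin n → ℝ) : Prop :=
  ∀ (B : Finset (Fin n)) (i : Fin n), lcpVal M q B i ≠ 0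

/-- `B(v) = {j : v_j = 1}`. -/
def vertexBasis {n : ℕ} (v : Vertex n) : Finset (Fin n) :=
  Finset.univ.filter (fun j => v j = true)

/-- The orientation induced by `LCP(M, q)`: `v → v ⊕ i` iff `(A_{B(v)}⁻¹ q)_i < 0`. -/
noncomputable def inducedOrientation {n : ℕ} (M : Matrix (Fin n) (Fin n) ℝ)
    (q : Fin n → ℝ) : CubeOrientation n :=
  fun v i => decide (lcpVal M q (vertexBasis v) i < 0)

/-- A P-USO: an orientation induced by an LCP with a P-matrix and nondegenerate `q`. -/
def IsPUSO {n : ℕ} (φ : CubeOrientation n) : Prop :=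
  ∃ (M : Matrix (Fin n) (Fin n) ℝ) (q : Fin n → ℝ),
    IsPMatrix M ∧ Nondegenerate M q ∧ φ = inducedOrientation M q

/-- A K-USO: an orientation induced by an LCP with a K-matrix and nondegenerate `q`. -/
def IsKUSO {n : ℕ} (φ : CubeOrientation n) : Prop :=
  ∃ (M : Matrix (Fin n) (Fin n) ℝ) (q : Fin n → ℝ),
    IsKMatrix M ∧ Nondegenerate M q ∧ φ = inducedOrientation M q

open MvPolynomial Filter Topology

theorem hasFDerivAt_eval {ι : Type*} [Fintype ι] (p : MvPolynomial ι ℝ) (x : ι → ℝ) :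
    HasFDerivAt (fun y : ι → ℝ => eval y p)
      (∑ i, eval x (pderiv i p) • (ContinuousLinearMap.proj i : (ι → ℝ) →L[ℝ] ℝ)) x := by
  classical
  induction p using MvPolynomial.induction_on with
  | C a => simpa using hasFDerivAt_const a x
  | add p q hp hq =>
    simp only [map_add, add_smul, Finset.sum_add_distrib]
    exact hp.add hq
  | mul_X p j hp =>
    have h := hp.mul (ContinuousLinearMap.proj (R := ℝ) (φ := fun _ : ι => ℝ) j).hasFDerivAt (x := x)
    simp only [map_mul, eval_X]
    refine h.congr_fderiv ?_
    ext v
    simp [pderiv_X, Pi.single_apply, mul_add, Finset.sum_add_distrib, Finset.mul_sum,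
      mul_comm, mul_left_comm, apply_ite]

theorem contDiff_eval {ι : Type*} [Fintype ι] (p : MvPolynomial ι ℝ) :
    ContDiff ℝ 1 (fun y : ι → ℝ => eval y p) := by
  induction p using MvPolynomial.induction_on with
  | C a => simpa using contDiff_const
  | add p q hp hq => simpa using hp.add hq
  | mul_X p j hp => simpa using hp.mul (contDiff_apply ℝ ℝ j)

theorem totalDegree_pderiv_le {ι R : Type*} [CommSemiring R] (i : ι) (p : MvPolynomial ι R) :
    (pderiv i p).totalDegree ≤ p.totalDegree := by
  classical
  rw [p.as_sum, map_sum]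
  refine (totalDegree_finsetSum _ _).trans (Finset.sup_le fun s hs => ?_)
  rw [← p.as_sum, pderiv_monomial]
  refine (totalDegree_monomial_le _ _).trans ?_
  refine le_trans ?_ (le_totalDegree hs)
  exact Finsupp.sum_le_sum_index (by intro j; simp) (by intro _ _ a b h; exact h) (by simp)

theorem linearIndependent_mul_prod_pow {ι : Type*} [Fintype ι] (g : ι → MvPolynomial ι ℝ)
    (Z : Finset (ι → ℝ)) (hz : ∀ z ∈ Z, ∀ i, eval z (g i) = 0)
    (hdet : ∀ z ∈ Z, (fderiv ℝ (fun (x : ι → ℝ) (i : ι) => eval x (g i)) z).det ≠ 0)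
    (b : (ι → ℝ) → MvPolynomial ι ℝ) (hb : ∀ z ∈ Z, eval z (b z) = 1)
    (hb' : ∀ z ∈ Z, ∀ w ∈ Z, w ≠ z → eval w (b z) = 0) :
    LinearIndependent ℝ
      (fun a : Z × (ι →₀ ℕ) => b a.1 * a.2.prod fun i k => g i ^ k) := by
  classical
  rw [linearIndependent_iff']
  intro s c hc
  suffices H : ∀ r : ℕ, ∀ a ∈ s, a.2.degree = r → c a = 0 from fun a ha => H _ a ha rfl
  intro r
  induction r using Nat.strong_induction_on with
  | _ r ih =>
  rintro ⟨z, α⟩ ha hα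
  set G : (ι → ℝ) → ι → ℝ := fun x i => eval x (g i) with hG
  set L := fderiv ℝ G z with hL
  have hGz : HasFDerivAt G L z := by
    apply DifferentiableAt.hasFDerivAt
    exact differentiableAt_pi.2 fun i => (hasFDerivAt_eval (g i) z).differentiableAt
  have hsurj : Function.Surjective L := by
    have h := hdet z z.2
    exact (LinearMap.equivOfDetNeZero (L : (ι → ℝ) →ₗ[ℝ] (ι → ℝ)) h).surjective
  have key : ∑ a ∈ s with a.1 = z ∧ a.2.degree = r, monomial a.2 (c a) = 0 := by
    apply MvPolynomial.funext
    intro y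
    obtain ⟨v, rfl⟩ := hsurj y
    have hline : HasDerivAt (fun t : ℝ => G (z + t • v)) (L v) 0 := by
      have h1 : HasDerivAt (fun t : ℝ => (z : ι → ℝ) + t • v) v 0 := by
        simpa using ((hasDerivAt_id (0 : ℝ)).smul_const v).const_add (z : ι → ℝ)
      have h2 : HasFDerivAt G L ((z : ι → ℝ) + (0 : ℝ) • v) := by simpa using hGz
      exact h2.comp_hasDerivAt (0 : ℝ) h1
    have hslope : ∀ i, Tendsto (fun t : ℝ => t⁻¹ * eval ((z : ι → ℝ) + t • v) (g i)) (𝓝[≠] 0)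
        (𝓝 (L v i)) := by
      intro i
      have := (hasDerivAt_pi.1 hline i).tendsto_slope
      refine this.congr fun t => ?_
      simp [slope, hG, hz z z.2 i]
    have hbc : ∀ w, Tendsto (fun t : ℝ => eval ((z : ι → ℝ) + t • v) (b w)) (𝓝[≠] 0)
        (𝓝 (eval z (b w))) := by
      intro w
      have hcont : Continuous fun t : ℝ => eval ((z : ι → ℝ) + t • v) (b w) :=
        (contDiff_eval (b w)).continuous.comp (by fun_prop)
      have := (hcont.tendsto 0).mono_left (nhdsWithin_le_nhds (s := {0}ᶜ))
      simpa using this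
    have hterm : ∀ a ∈ s, Tendsto (fun t : ℝ => (t⁻¹) ^ r *
          eval ((z : ι → ℝ) + t • v) (c a • (b a.1 * a.2.prod fun i k => g i ^ k))) (𝓝[≠] 0)
        (𝓝 (c a * eval z (b a.1) * 0 ^ (a.2.degree - r) * ∏ i, L v i ^ a.2 i)) := by
      intro a ha
      rcases lt_or_ge a.2.degree r with h | h
      · simp [ih _ h a ha rfl]
      · have hT : Tendsto (fun t : ℝ => t) (𝓝[≠] 0) (𝓝 0) :=
          tendsto_id.mono_left nhdsWithin_le_nhds
        have := (((hbc a.1).const_mul (c a)).mul (hT.pow (a.2.degree - r))).mul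
          (tendsto_finsetProd Finset.univ fun i _ => (hslope i).pow (a.2 i))
        refine this.congr' ?_
        filter_upwards [self_mem_nhdsWithin] with t ht
        have ht : t ≠ 0 := ht
        simp only [mul_pow, Finset.prod_mul_distrib, Finset.prod_pow_eq_pow_sum, smul_eval,
          map_mul, Finsupp.prod_fintype _ _ (fun i => pow_zero (g i)), map_prod, map_pow]
        rw [← Finsupp.degree_eq_sum]
        have hpow : (t⁻¹) ^ r = t ^ (a.2.degree - r) * (t⁻¹) ^ a.2.degree := by
          obtain ⟨k, hk⟩ := Nat.exists_eq_add_of_le h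
          rw [hk, Nat.add_sub_cancel_left, pow_add, mul_comm (t⁻¹ ^ r), ← mul_assoc, ← mul_pow,
            mul_inv_cancel₀ ht, one_pow, one_mul]
        rw [hpow]
        ring
    have hsum := tendsto_finsetSum s hterm
    have hzero : ∀ t : ℝ, ∑ a ∈ s, (t⁻¹) ^ r *
        eval ((z : ι → ℝ) + t • v) (c a • (b a.1 * a.2.prod fun i k => g i ^ k)) = 0 := by
      intro t
      rw [← Finset.mul_sum, ← map_sum, hc, map_zero, mul_zero]
    simp only [hzero] at hsum
    have hlim := tendsto_nhds_unique hsum tendsto_const_nhds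
    rw [map_zero, ← hlim, map_sum, Finset.sum_filter]
    refine Finset.sum_congr rfl fun a ha => ?_
    by_cases h1 : a.1 = z
    · rcases lt_trichotomy a.2.degree r with h | h | h
      · simp [ih _ h a ha rfl]
      · rw [if_pos ⟨h1, h⟩, h1, hb z z.2, h]
        simp [eval_monomial, Finsupp.prod_fintype]
      · rw [if_neg (by omega), zero_pow (by omega)]
        simp
    · rw [if_neg (by tauto), hb' a.1 a.1.2 z z.2 (fun h => h1 (Subtype.ext h.symm))]
      simp
  have := congrArg (coeff α) key
  rw [coeff_sum, coeff_zero, Finset.sum_eq_single_of_mem (z, α) (by simp [ha, hα])] at this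
  · simpa using this
  · rintro ⟨w, β⟩ hw hne
    simp only [Finset.mem_filter] at hw
    rw [coeff_monomial, if_neg]
    rintro rfl
    exact hne (by rw [← hw.2.1])

theorem le_of_forall_mul_le_mul_add {a : ℕ → ℕ} {m B c N : ℕ} (h0 : 0 < a 0)
    (ha : ∀ T, a T ≤ (T + 1) ^ N) (h : ∀ T, m * a T ≤ B * a (T + c)) : m ≤ B := by
  by_contra! hlt
  have hB : 0 < B := by
    rcases Nat.eq_zero_or_pos B with rfl | hB
    · have := h 0
      simp only [zero_mul, Nat.le_zero, mul_eq_zero] at this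
      omega
    · exact hB
  have hpow : ∀ k, m ^ k * a 0 ≤ B ^ k * a (k * c) := by
    intro k
    induction k with
    | zero => simp
    | succ k ih =>
      calc m ^ (k + 1) * a 0 = m * (m ^ k * a 0) := by ring
        _ ≤ m * (B ^ k * a (k * c)) := by gcongr
        _ = B ^ k * (m * a (k * c)) := by ring
        _ ≤ B ^ k * (B * a (k * c + c)) := Nat.mul_le_mul_left _ (h _)
        _ = B ^ (k + 1) * a ((k + 1) * c) := by rw [pow_succ, mul_assoc, Nat.succ_mul]
  have hBR : (0 : ℝ) < B := by exact_mod_cast hB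
  have hr : (1 : ℝ) < m / B := (one_lt_div hBR).2 (by exact_mod_cast hlt)
  have hc : (0 : ℝ) < 1 / ((c : ℝ) + 1) ^ N := by positivity
  obtain ⟨k, hk, hk1⟩ := (((tendsto_pow_const_div_const_pow_of_one_lt N hr).eventually
    (gt_mem_nhds hc)).and (eventually_ge_atTop 1)).exists
  have h1 : m ^ k ≤ B ^ k * (k * (c + 1)) ^ N :=
    calc m ^ k ≤ m ^ k * a 0 := Nat.le_mul_of_pos_right _ h0
      _ ≤ B ^ k * a (k * c) := hpow k
      _ ≤ B ^ k * (k * c + 1) ^ N := Nat.mul_le_mul_left _ (ha _)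
      _ ≤ B ^ k * (k * (c + 1)) ^ N := by gcongr; nlinarith
  have h2 : (m : ℝ) ^ k ≤ B ^ k * (k * (c + 1)) ^ N := by exact_mod_cast h1
  have h3 : (0 : ℝ) < (m : ℝ) / B := by linarith
  rw [div_lt_div_iff₀ (by positivity) (by positivity), div_pow, one_mul, ← mul_pow,
    lt_div_iff₀ (by positivity)] at hk
  linarith

open Classical in
/-- The exponent vectors of total degree at most `T`. -/
noncomputable def degreeLE (ι : Type*) [Fintype ι] (T : ℕ) : Finset (ι →₀ ℕ) :=
  (Finset.Iic (Finsupp.equivFunOnFinite.symm fun _ => T)).filter fun α => α.degree ≤ T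

theorem mem_degreeLE {ι : Type*} [Fintype ι] {T : ℕ} {α : ι →₀ ℕ} :
    α ∈ degreeLE ι T ↔ α.degree ≤ T := by
  simp only [degreeLE, Finset.mem_filter, Finset.mem_Iic, and_iff_right_iff_imp]
  intro h i
  exact (Finsupp.le_degree i α).trans h

theorem card_degreeLE_le {ι : Type*} [Fintype ι] (T : ℕ) :
    (degreeLE ι T).card ≤ (T + 1) ^ Fintype.card ι := by
  classical
  calc (degreeLE ι T).card ≤ (Fintype.piFinset fun _ : ι => Finset.range (T + 1)).card := by
        refine Finset.card_le_card_of_injOn (fun α i => α i) ?_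
          (fun α _ β _ h => DFunLike.coe_injective h)
        intro α hα
        have hα := mem_degreeLE.1 hα
        simpa [Nat.lt_succ_iff] using fun i => (Finsupp.le_degree i α).trans hα
    _ = (T + 1) ^ Fintype.card ι := by simp

theorem card_degreeLE_add_mul_le {ι : Type*} [Fintype ι] {D : ℕ} (hD : 0 < D) (c T : ℕ) :
    (degreeLE ι (c + D * T)).card ≤ D ^ Fintype.card ι * (degreeLE ι (T + c)).card := by
  classical
  calc (degreeLE ι (c + D * T)).card
      ≤ ((Fintype.piFinset fun _ : ι => Finset.range D) ×ˢ degreeLE ι (T + c)).card := by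
        refine Finset.card_le_card_of_injOn
          (fun α => (fun i => α i % D, Finsupp.equivFunOnFinite.symm fun i => α i / D)) ?_ ?_
        · intro α hα
          have hα := mem_degreeLE.1 hα
          simp only [Finset.coe_product, Set.mem_prod, Finset.mem_coe, Fintype.mem_piFinset,
            Finset.mem_range, mem_degreeLE, Finsupp.degree_eq_sum] at hα ⊢
          refine ⟨fun i => Nat.mod_lt _ hD, ?_⟩
          refine Nat.le_of_mul_le_mul_left ?_ hD
          rw [Finset.mul_sum]
          calc ∑ i, D * (α i / D) ≤ ∑ i, α i :=
                Finset.sum_le_sum fun i _ => Nat.mul_div_le (α i) D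
            _ ≤ c + D * T := hα
            _ ≤ D * (T + c) := by nlinarith
        · intro α _ β _ h
          ext i
          have h1 := congrFun (congrArg Prod.fst h) i
          have h2 := DFunLike.congr_fun (congrArg Prod.snd h) i
          simp only [Finsupp.equivFunOnFinite_symm_apply_apply] at h1 h2
          rw [← Nat.div_add_mod (α i) D, ← Nat.div_add_mod (β i) D, h1, h2]
    _ = D ^ Fintype.card ι * (degreeLE ι (T + c)).card := by simp

theorem finrank_restrictTotalDegree {ι : Type*} [Fintype ι] (T : ℕ) :
    Module.finrank ℝ (restrictTotalDegree ι ℝ T) = (degreeLE ι T).card := by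
  have h : {s : ι →₀ ℕ | (s.sum fun _ e => e) ≤ T} = degreeLE ι T := by
    ext s
    simp [mem_degreeLE, Finsupp.degree_eq_sum, Finsupp.sum_fintype]
  rw [restrictTotalDegree, Module.finrank_eq_nat_card_basis (basisRestrictSupport ℝ
    {s : ι →₀ ℕ | (s.sum fun _ e => e) ≤ T}), h]
  simp

theorem exists_eval_eq_ite {ι : Type*} (Z : Finset (ι → ℝ)) (z : ι → ℝ) :
    ∃ b : MvPolynomial ι ℝ, eval z b = 1 ∧ ∀ w ∈ Z, w ≠ z → eval w b = 0 := by
  classical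
  have h : ∀ w : ι → ℝ, ∃ b : MvPolynomial ι ℝ, w ≠ z → eval z b = 1 ∧ eval w b = 0 := by
    intro w
    by_cases hw : w = z
    · exact ⟨0, fun h => absurd hw h⟩
    · obtain ⟨i, hi⟩ := Function.ne_iff.1 hw
      refine ⟨C (z i - w i)⁻¹ * (X i - C (w i)), fun _ => ⟨?_, by simp⟩⟩
      simpa using inv_mul_cancel₀ (sub_ne_zero.2 (Ne.symm hi))
  choose b hb using h
  refine ⟨∏ w ∈ Z.erase z, b w, ?_, fun w hw hne => ?_⟩
  · rw [map_prod]
    exact Finset.prod_eq_one fun w hw => (hb w (Finset.ne_of_mem_erase hw)).1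
  · rw [map_prod]
    exact Finset.prod_eq_zero (Finset.mem_erase.2 ⟨hne, hw⟩) (hb w hne).2

/-- Bézout's bound for nondegenerate zeros. -/
theorem card_nondegenerate_zeros_le {ι : Type*} [Fintype ι] (g : ι → MvPolynomial ι ℝ)
    {D : ℕ} (hD : 0 < D) (hg : ∀ i, (g i).totalDegree ≤ D)
    (Z : Finset (ι → ℝ)) (hz : ∀ z ∈ Z, ∀ i, eval z (g i) = 0)
    (hdet : ∀ z ∈ Z, (fderiv ℝ (fun (x : ι → ℝ) (i : ι) => eval x (g i)) z).det ≠ 0) :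
    Z.card ≤ D ^ Fintype.card ι := by
  classical
  choose b hb hb' using exists_eval_eq_ite Z
  have hli := linearIndependent_mul_prod_pow g Z hz hdet b (fun z _ => hb z)
    (fun z _ => hb' z)
  set c := Z.sup fun z => (b z).totalDegree with hc
  refine le_of_forall_mul_le_mul_add (a := fun T => (degreeLE ι T).card) (c := c)
    (N := Fintype.card ι) ?_ (fun T => card_degreeLE_le T) fun T => ?_
  · exact Finset.card_pos.2 ⟨0, mem_degreeLE.2 (by simp)⟩
  refine le_trans ?_ (card_degreeLE_add_mul_le hD c T)
  have hmem : ∀ a : Z × degreeLE ι T,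
      b a.1 * (a.2 : ι →₀ ℕ).prod (fun i k => g i ^ k) ∈
        restrictTotalDegree ι ℝ (c + D * T) := by
    rintro ⟨z, α, hα⟩
    rw [mem_restrictTotalDegree]
    refine (totalDegree_mul _ _).trans (add_le_add ?_ ?_)
    · exact Finset.le_sup (f := fun z => (b z).totalDegree) z.2
    · rw [mem_degreeLE, Finsupp.degree_eq_sum] at hα
      rw [Finsupp.prod_fintype _ _ (fun i => pow_zero (g i))]
      refine (totalDegree_finsetProd _ _).trans ?_
      calc ∑ i, (g i ^ α i).totalDegree ≤ ∑ i, D * α i := by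
            refine Finset.sum_le_sum fun i _ => (totalDegree_pow _ _).trans ?_
            rw [mul_comm]
            exact Nat.mul_le_mul_right _ (hg i)
        _ ≤ D * T := by rw [← Finset.mul_sum]; exact Nat.mul_le_mul_left _ hα
  have hli2 : LinearIndependent ℝ fun a : Z × degreeLE ι T =>
      (⟨_, hmem a⟩ : restrictTotalDegree ι ℝ (c + D * T)) := by
    refine LinearIndependent.of_comp (restrictTotalDegree ι ℝ (c + D * T)).subtype ?_
    exact hli.comp (fun a : Z × degreeLE ι T => (a.1, (a.2 : ι →₀ ℕ)))
      (fun a a' h => by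
        simp only [Prod.mk.injEq] at h
        exact Prod.ext h.1 (Subtype.ext h.2))
  have := hli2.fintype_card_le_finrank
  rwa [finrank_restrictTotalDegree, Fintype.card_prod, Fintype.card_coe, Fintype.card_coe] at this

theorem hasDerivAt_max_zero_sq (y : ℝ) :
    HasDerivAt (fun t : ℝ => max t 0 ^ 2) (2 * max y 0) y := by
  rcases lt_trichotomy y 0 with h | rfl | h
  · rw [max_eq_right h.le, mul_zero]
    refine (hasDerivAt_const y (0 : ℝ)).congr_of_eventuallyEq ?_
    filter_upwards [gt_mem_nhds h] with t ht
    simp [max_eq_right ht.le]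
  · rw [max_self, mul_zero, hasDerivAt_iff_isLittleO_nhds_zero]
    have hle : (fun t : ℝ => max (0 + t) 0 ^ 2 - max (0 : ℝ) 0 ^ 2 - t • (0 : ℝ)) =O[𝓝 0]
        fun t => t ^ 2 := by
      refine Asymptotics.isBigO_of_le _ fun t => ?_
      rcases le_total t 0 with ht | ht <;> simp [ht, sq_nonneg]
    exact hle.trans_isLittleO (Asymptotics.isLittleO_pow_id one_lt_two)
  · rw [max_eq_left h.le]
    have := hasDerivAt_pow 2 y
    simp only [Nat.cast_ofNat, Nat.add_one_sub_one, pow_one] at this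
    refine this.congr_of_eventuallyEq ?_
    filter_upwards [lt_mem_nhds h] with t ht
    simp [max_eq_left ht.le]

/-- The squared distance to `u` plus a penalty for violating `p j ≥ ε j` for `j ∈ P`. -/
noncomputable def penalized {ι J : Type*} [Fintype ι] (p : J → MvPolynomial ι ℝ) (ε : J → ℝ)
    (κ : ℝ) (u : ι → ℝ) (P : Finset J) (x : ι → ℝ) : ℝ :=
  ∑ i, (x i - u i) ^ 2 + κ * ∑ j ∈ P, max (ε j - eval x (p j)) 0 ^ 2

theorem exists_penalized_minimizer {ι J : Type*} [Fintype ι] (p : J → MvPolynomial ι ℝ)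
    (ε : J → ℝ) {κ : ℝ} (hκ : 0 ≤ κ) (u : ι → ℝ) (P : Finset J) :
    ∃ x, ∀ y, penalized p ε κ u P x ≤ penalized p ε κ u P y := by
  have hcont : Continuous (penalized p ε κ u P) := by
    have := fun j => (contDiff_eval (p j)).continuous
    unfold penalized
    fun_prop
  refine hcont.exists_forall_le' u ?_
  filter_upwards [tendsto_norm_cocompact_atTop.eventually_ge_atTop
    (penalized p ε κ u P u + 1 + ‖u‖)] with x hx
  have h1 : ‖x - u‖ ≤ 1 + ∑ i, (x i - u i) ^ 2 := by
    refine (pi_norm_le_iff_of_nonneg (by positivity)).2 fun i => ?_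
    have h2 : (x i - u i) ^ 2 ≤ ∑ i, (x i - u i) ^ 2 :=
      Finset.single_le_sum (f := fun i => (x i - u i) ^ 2) (fun i _ => sq_nonneg _)
        (Finset.mem_univ i)
    rw [Pi.sub_apply, Real.norm_eq_abs]
    nlinarith [sq_abs (x i - u i), sq_nonneg (|x i - u i| - 1), abs_nonneg (x i - u i)]
  have h3 : ∑ i, (x i - u i) ^ 2 ≤ penalized p ε κ u P x :=
    le_add_of_nonneg_right (by positivity)
  have h4 := norm_le_norm_add_norm_sub' x u
  linarith

theorem penalized_critical {ι J : Type*} [Fintype ι] (p : J → MvPolynomial ι ℝ)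
    (ε : J → ℝ) (κ : ℝ) (u : ι → ℝ) (P : Finset J) {x : ι → ℝ}
    (hx : ∀ y, penalized p ε κ u P x ≤ penalized p ε κ u P y) (i : ι) :
    x i + κ * ∑ j ∈ P with eval x (p j) < ε j, (eval x (p j) - ε j) * eval x (pderiv i (p j))
      = u i := by
  classical
  have h1 : HasFDerivAt (fun x : ι → ℝ => ∑ i, (x i - u i) ^ 2)
      (∑ i, (2 * (x i - u i)) • (ContinuousLinearMap.proj i : (ι → ℝ) →L[ℝ] ℝ)) x := by
    refine HasFDerivAt.fun_sum fun i _ => ?_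
    have := (((ContinuousLinearMap.proj (R := ℝ) (φ := fun _ : ι => ℝ) i).hasFDerivAt
      (x := x)).sub_const (u i)).pow 2
    simpa using this
  have h2 : HasFDerivAt (fun x : ι → ℝ => ∑ j ∈ P, max (ε j - eval x (p j)) 0 ^ 2)
      (∑ j ∈ P, (2 * max (ε j - eval x (p j)) 0) •
        -∑ i, eval x (pderiv i (p j)) • (ContinuousLinearMap.proj i : (ι → ℝ) →L[ℝ] ℝ)) x :=
    HasFDerivAt.fun_sum fun j _ => (hasDerivAt_max_zero_sq _).comp_hasFDerivAt x
      ((hasFDerivAt_eval (p j) x).const_sub (ε j))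
  have hmin : IsLocalMin (penalized p ε κ u P) x := Eventually.of_forall hx
  have h3 := hmin.hasFDerivAt_eq_zero (h1.add (h2.const_mul κ))
  have h4 := congrArg (fun L : (ι → ℝ) →L[ℝ] ℝ => L (Pi.single i 1)) h3
  simp only [_root_.add_apply, _root_.sum_apply,
    _root_.smul_apply, _root_.neg_apply,
    ContinuousLinearMap.proj_apply, Pi.single_apply, smul_eq_mul, mul_ite, mul_one, mul_zero,
    Finset.sum_ite_eq', Finset.mem_univ, if_true, _root_.zero_apply] at h4
  have h5 : ∑ j ∈ P with eval x (p j) < ε j, (eval x (p j) - ε j) * eval x (pderiv i (p j)) =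
      2⁻¹ * ∑ j ∈ P, 2 * max (ε j - eval x (p j)) 0 * -eval x (pderiv i (p j)) := by
    rw [Finset.sum_filter, Finset.mul_sum]
    refine Finset.sum_congr rfl fun j _ => ?_
    split_ifs with h
    · rw [max_eq_left (by linarith)]; ring
    · rw [max_eq_right (by linarith)]; ring
  rw [h5]
  linarith

theorem exists_generic_levels {ι J : Type*} [Fintype ι] [Fintype J] (p : J → MvPolynomial ι ℝ)
    {ρ : ℝ} (hρ : 0 < ρ) :
    ∃ ε : J → ℝ, (∀ j, ε j < ρ) ∧ ∃ η > 0, (∀ j, η ≤ ε j) ∧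
      ∀ (x : ι → ℝ) (T : Finset J), (∀ j ∈ T, |eval x (p j) - ε j| < η) →
        T.card ≤ Fintype.card ι := by
  classical
  have hf : ∀ T : Finset J, ∃ f : MvPolynomial T ℝ, f ≠ 0 ∧
      (Fintype.card ι < T.card → aeval (fun j : T => p j) f = 0) := by
    intro T
    by_cases hT : Fintype.card ι < T.card
    · have hdep : ¬ AlgebraicIndependent ℝ fun j : T => p j := by
        intro h
        have := h.lift_cardinalMk_le_trdeg
        rw [trdeg_of_isDomain] at this
        simp only [Cardinal.mk_fintype, Cardinal.lift_natCast, Nat.cast_le,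
          Fintype.card_coe] at this
        omega
      rw [algebraicIndependent_iff] at hdep
      push Not at hdep
      obtain ⟨f, h0, hne⟩ := hdep
      exact ⟨f, hne, fun _ => h0⟩
    · exact ⟨1, one_ne_zero, fun h => absurd h hT⟩
  choose f hf0 hf using hf
  have hprod : ∏ T : Finset J, rename (Subtype.val : T → J) (f T) ≠ 0 :=
    Finset.prod_ne_zero_iff.2 fun T _ =>
      (map_ne_zero_iff _ (rename_injective _ Subtype.val_injective)).2 (hf0 T)
  obtain ⟨ε, hε, hne⟩ : ∃ ε ∈ Set.pi Set.univ fun _ : J => Set.Ioo 0 ρ,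
      eval ε (∏ T : Finset J, rename (Subtype.val : T → J) (f T)) ≠ 0 := by
    by_contra! h
    refine hprod (MvPolynomial.funext_set (fun _ => Set.Ioo 0 ρ)
      (fun _ => Set.Ioo_infinite hρ) fun x hx => ?_)
    rw [h x hx, map_zero]
  rw [map_prod, Finset.prod_ne_zero_iff] at hne
  have hε : ∀ j, 0 < ε j ∧ ε j < ρ := fun j => hε j (Set.mem_univ j)
  have hloc : ∀ T : Finset J, ∃ r > 0, ∀ y : T → ℝ,
      dist y (fun j => ε j) < r → eval y (f T) ≠ 0 := by
    intro T
    have h := hne T (Finset.mem_univ T)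
    rw [eval_rename] at h
    have := ((contDiff_eval (f T)).continuous.continuousAt (x := fun j : T => ε j)).eventually_ne h
    exact Metric.eventually_nhds_iff.1 this
  choose r hr hloc using hloc
  have hev : ∀ᶠ η in 𝓝[>] (0 : ℝ), (∀ j, η ≤ ε j) ∧ ∀ T, η ≤ r T := by
    refine (eventually_all.2 fun j => ?_).and (eventually_all.2 fun T => ?_)
    · exact nhdsWithin_le_nhds (eventually_le_nhds (hε j).1)
    · exact nhdsWithin_le_nhds (eventually_le_nhds (hr T))
  obtain ⟨η, ⟨h1, h2⟩, hη⟩ := (hev.and self_mem_nhdsWithin).exists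
  refine ⟨ε, fun j => (hε j).2, η, hη, h1, fun x T hT => ?_⟩
  by_contra! hcard
  refine hloc T (fun j => eval x (p j)) ?_ ?_
  · rw [dist_pi_lt_iff (hr T)]
    exact fun j => (hT j j.2).trans_le (h2 T)
  · have h0 := congrArg (eval x) (hf T hcard)
    have hid : (eval x).comp (algebraMap ℝ (MvPolynomial ι ℝ)) = RingHom.id ℝ := by
      ext; simp
    rw [map_zero, map_aeval, hid] at h0
    exact h0

theorem exists_common_regular_value {ι K : Type*} [Fintype ι] [Finite K]
    (Ψ : K → (ι → ℝ) → ι → ℝ) (hΨ : ∀ k, Differentiable ℝ (Ψ k)) :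
    ∃ u : ι → ℝ, ‖u‖ < 1 ∧ ∀ k x, Ψ k x = u → (fderiv ℝ (Ψ k) x).det ≠ 0 := by
  have hnull : MeasureTheory.volume
      (⋃ k, Ψ k '' {x | (fderiv ℝ (Ψ k) x).det = 0}) = 0 := by
    refine (MeasureTheory.measure_iUnion_null_iff).2 fun k => ?_
    exact MeasureTheory.addHaar_image_eq_zero_of_det_fderivWithin_eq_zero _
      (fun x _ => ((hΨ k) x).hasFDerivAt.hasFDerivWithinAt) fun x hx => hx
  by_contra! h
  have hsub : Metric.ball (0 : ι → ℝ) 1 ⊆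
      ⋃ k, Ψ k '' {x | (fderiv ℝ (Ψ k) x).det = 0} := by
    intro u hu
    obtain ⟨k, x, hx, hdet⟩ := h u (by simpa using hu)
    exact Set.mem_iUnion.2 ⟨k, x, hdet, hx⟩
  exact (Metric.measure_ball_pos MeasureTheory.volume (0 : ι → ℝ) one_pos).ne'
    (MeasureTheory.measure_mono_null hsub hnull)

theorem card_filter_card_le {J : Type*} [Fintype J] (N : ℕ) :
    (Finset.univ.filter fun S : Finset J => S.card ≤ N).card ≤
      ∑ k ∈ Finset.range (N + 1), (Fintype.card J).choose k := by
  classical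
  have h : (Finset.univ.filter fun S : Finset J => S.card ≤ N) ⊆
      (Finset.range (N + 1)).biUnion fun k => Finset.univ.powersetCard k := by
    intro S hS
    simpa [Nat.lt_succ_iff] using hS
  refine (Finset.card_le_card h).trans (Finset.card_biUnion_le.trans ?_)
  simp [Finset.card_powersetCard]

/-- Warren's bound: a family of nonempty, pairwise disjoint regions, each cut out by positivity
conditions `p j > 0` with `j` in a finite index type, is bounded in number. -/
theorem card_le_of_disjoint_positivity {ι J W : Type*} [Fintype ι] [Fintype J] [Fintype W]
    (p : J → MvPolynomial ι ℝ) {d : ℕ} (hd : 0 < d) (hp : ∀ j, (p j).totalDegree ≤ d)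
    (P : W → Finset J) (hpos : ∀ w, ∃ x : ι → ℝ, ∀ j ∈ P w, 0 < eval x (p j))
    (hdisj : ∀ (w w' : W) (x : ι → ℝ), (∀ j ∈ P w, 0 < eval x (p j)) →
      (∀ j ∈ P w', 0 < eval x (p j)) → w = w') :
    Fintype.card W ≤ (∑ k ∈ Finset.range (Fintype.card ι + 1), (Fintype.card J).choose k) *
      (2 * d) ^ Fintype.card ι := by
  classical
  choose a ha using hpos
  obtain ⟨ρ, hρa, hρ⟩ : ∃ ρ : ℝ, (∀ w, ∀ j ∈ P w, ρ ≤ eval (a w) (p j)) ∧ 0 < ρ := by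
    have hev : ∀ᶠ ρ in 𝓝[>] (0 : ℝ), ∀ w, ∀ j, j ∈ P w → ρ ≤ eval (a w) (p j) := by
      refine eventually_all.2 fun w => eventually_all.2 fun j => eventually_imp_distrib_left.2
        fun hj => ?_
      exact nhdsWithin_le_nhds (eventually_le_nhds (ha w j hj))
    exact (hev.and self_mem_nhdsWithin).exists
  obtain ⟨ε, hερ, η, hη, hηε, hgen⟩ := exists_generic_levels p hρ
  set c : ℝ := ∑ w, ∑ i, (|a w i| + 1) ^ 2 with hc
  have hc0 : 0 ≤ c := by positivity
  set κ : ℝ := (c + 1) / η ^ 2 with hκ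
  have hκ0 : 0 < κ := by positivity
  set ψ : Finset J → ι → MvPolynomial ι ℝ := fun S i =>
    X i + C κ * ∑ j ∈ S, (p j - C (ε j)) * pderiv i (p j) with hψ
  have hψdiff : ∀ S, Differentiable ℝ fun (x : ι → ℝ) (i : ι) => eval x (ψ S i) := fun S =>
    differentiable_pi.2 fun i => (contDiff_eval (ψ S i)).differentiable one_ne_zero
  obtain ⟨u, hu, hreg⟩ := exists_common_regular_value _ hψdiff
  choose m hm using fun w => exists_penalized_minimizer p ε hκ0.le u (P w)
  set act : W → Finset J := fun w => (P w).filter fun j => eval (m w) (p j) < ε j with hact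
  have hcrit : ∀ w i, eval (m w) (ψ (act w) i) = u i := by
    intro w i
    rw [← penalized_critical p ε κ u (P w) (hm w) i]
    simp [hψ, hact]
  have hval : ∀ w, penalized p ε κ u (P w) (m w) ≤ c := by
    intro w
    refine (hm w (a w)).trans ?_
    have h0 : ∑ j ∈ P w, max (ε j - eval (a w) (p j)) 0 ^ 2 = 0 := by
      refine Finset.sum_eq_zero fun j hj => ?_
      rw [max_eq_right (by linarith [hρa w j hj, hερ j])]
      norm_num
    rw [penalized, h0, mul_zero, add_zero]
    refine le_trans (Finset.sum_le_sum fun i _ => ?_)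
      (Finset.single_le_sum (f := fun w => ∑ i, (|a w i| + 1) ^ 2)
        (fun w _ => by positivity) (Finset.mem_univ w))
    have h1 : |u i| ≤ 1 := (norm_le_pi_norm u i).trans hu.le
    have h2 : |a w i - u i| ≤ |a w i| + 1 := (abs_sub _ _).trans (by linarith)
    exact sq_le_sq' (by linarith [neg_abs_le (a w i - u i)]) ((le_abs_self _).trans h2)
  have hnear : ∀ w, ∀ j ∈ P w, ε j - η < eval (m w) (p j) := by
    intro w j hj
    by_contra! hle
    have h1 : η ^ 2 ≤ max (ε j - eval (m w) (p j)) 0 ^ 2 :=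
      pow_le_pow_left₀ hη.le (le_max_of_le_left (by linarith)) 2
    have h2 : max (ε j - eval (m w) (p j)) 0 ^ 2 ≤
        ∑ j ∈ P w, max (ε j - eval (m w) (p j)) 0 ^ 2 :=
      Finset.single_le_sum (f := fun j => max (ε j - eval (m w) (p j)) 0 ^ 2)
        (fun j _ => sq_nonneg _) hj
    have h3 : κ * η ^ 2 ≤ c := by
      refine le_trans ?_ (hval w)
      exact (mul_le_mul_of_nonneg_left (h1.trans h2) hκ0.le).trans
        (le_add_of_nonneg_left (by positivity))
    rw [hκ, div_mul_cancel₀ _ (by positivity)] at h3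
    linarith
  have hmpos : ∀ w, ∀ j ∈ P w, 0 < eval (m w) (p j) := fun w j hj => by
    linarith [hnear w j hj, hηε j]
  have hinj : Function.Injective m := fun w w' h =>
    hdisj w w' (m w) (hmpos w) (h ▸ hmpos w')
  have hcard : ∀ w, (act w).card ≤ Fintype.card ι := by
    refine fun w => hgen (m w) (act w) fun j hj => ?_
    obtain ⟨hj, hlt⟩ := Finset.mem_filter.1 hj
    rw [abs_lt]
    constructor <;> linarith [hnear w j hj]
  have hfiber : ∀ S : Finset J, (Finset.univ.filter fun w => act w = S).card ≤
      (2 * d) ^ Fintype.card ι := by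
    intro S
    rw [← Finset.card_image_of_injective _ hinj]
    refine card_nondegenerate_zeros_le (fun i => ψ S i - C (u i)) (by omega) (fun i => ?_) _ ?_ ?_
    · refine (totalDegree_sub_C_le _ _).trans ((totalDegree_add _ _).trans (max_le ?_ ?_))
      · rw [totalDegree_X]; omega
      · refine (totalDegree_mul _ _).trans ?_
        rw [totalDegree_C, zero_add]
        refine (totalDegree_finsetSum _ _).trans (Finset.sup_le fun j _ => ?_)
        refine (totalDegree_mul _ _).trans ?_
        have h1 := (totalDegree_sub_C_le (p j) (ε j)).trans (hp j)
        have h2 := (totalDegree_pderiv_le i (p j)).trans (hp j)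
        omega
    · intro z hz i
      simp only [Finset.mem_image, Finset.mem_filter, Finset.mem_univ, true_and] at hz
      obtain ⟨w, rfl, rfl⟩ := hz
      rw [map_sub, hcrit, eval_C, sub_self]
    · intro z hz
      simp only [Finset.mem_image, Finset.mem_filter, Finset.mem_univ, true_and] at hz
      obtain ⟨w, rfl, rfl⟩ := hz
      have h1 : (fun (x : ι → ℝ) (i : ι) => eval x (ψ (act w) i - C (u i))) =
          fun x => (fun i => eval x (ψ (act w) i)) - u := by
        ext x i
        simp
      rw [h1, fderiv_sub_const]
      exact hreg (act w) (m w) (funext (hcrit w))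
  calc Fintype.card W = (Finset.univ : Finset W).card := rfl
    _ ≤ (2 * d) ^ Fintype.card ι *
        (Finset.univ.filter fun S : Finset J => S.card ≤ Fintype.card ι).card :=
      Finset.card_le_mul_card_image_of_maps_to
        (fun w _ => Finset.mem_filter.2 ⟨Finset.mem_univ (act w), hcard w⟩) _
        (fun S _ => hfiber S)
    _ ≤ _ := by
      rw [mul_comm]
      exact Nat.mul_le_mul_right _ (card_filter_card_le _)

theorem sum_range_choose_mul_pow_le_exp {s N : ℕ} (h : N ≤ s) :
    (∑ k ∈ Finset.range (N + 1), (s.choose k : ℝ)) * ((N : ℝ) / s) ^ N ≤ Real.exp N := by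
  rcases Nat.eq_zero_or_pos s with rfl | hs
  · obtain rfl : N = 0 := by omega
    simp
  have hsR : (0 : ℝ) < s := by exact_mod_cast hs
  set x : ℝ := (N : ℝ) / s with hx
  have hx0 : 0 ≤ x := by positivity
  have hx1 : x ≤ 1 := (div_le_one hsR).2 (by exact_mod_cast h)
  calc (∑ k ∈ Finset.range (N + 1), (s.choose k : ℝ)) * x ^ N
      ≤ ∑ k ∈ Finset.range (N + 1), (s.choose k : ℝ) * x ^ k := by
        rw [Finset.sum_mul]
        refine Finset.sum_le_sum fun k hk => mul_le_mul_of_nonneg_left ?_ (by positivity)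
        exact pow_le_pow_of_le_one hx0 hx1 (Nat.lt_succ_iff.1 (Finset.mem_range.1 hk))
    _ ≤ ∑ k ∈ Finset.range (s + 1), (s.choose k : ℝ) * x ^ k :=
        Finset.sum_le_sum_of_subset_of_nonneg (Finset.range_mono (by omega))
          fun k _ _ => by positivity
    _ = (x + 1) ^ s := by
        rw [add_pow]
        exact Finset.sum_congr rfl fun k _ => by rw [one_pow, mul_one, mul_comm]
    _ ≤ Real.exp x ^ s := pow_le_pow_left₀ (by positivity) (Real.add_one_le_exp x) s
    _ = Real.exp N := by
        rw [← Real.exp_nat_mul, hx, mul_div_cancel₀ _ hsR.ne']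

theorem totalDegree_det_le {n : ℕ} {σ : Type*} (A : Matrix (Fin n) (Fin n) (MvPolynomial σ ℝ))
    (hA : ∀ r s, (A r s).totalDegree ≤ 1) : A.det.totalDegree ≤ n := by
  rw [det_apply]
  refine (totalDegree_finsetSum _ _).trans (Finset.sup_le fun τ _ => ?_)
  refine (totalDegree_smul_le _ _).trans ((totalDegree_finsetProd _ _).trans ?_)
  calc ∑ i, (A (τ i) i).totalDegree ≤ ∑ _i : Fin n, 1 := Finset.sum_le_sum fun i _ => hA _ _
    _ = n := by simp

/-- The sign `(-1)^|B|` makes the determinant of `A_B` positive for a P-matrix. -/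
theorem IsPMatrix.det_ABmat_pos {n : ℕ} {M : Matrix (Fin n) (Fin n) ℝ} (hM : IsPMatrix M)
    (B : Finset (Fin n)) : 0 < (-1) ^ B.card * (ABmat M B).det := by
  classical
  rw [twoBlockTriangular_det' (ABmat M B) (fun i => i ∈ B)]
  · have h1 : (ABmat M B).toSquareBlockProp (fun i => i ∉ B) = 1 := by
      ext ⟨i, hi⟩ ⟨j, hj⟩
      simp [toSquareBlockProp, ABmat, hj, Matrix.one_apply]
    have h2 : (ABmat M B).toSquareBlockProp (fun i => i ∈ B) =
        -M.submatrix (fun i : B => (i : Fin n)) (fun i : B => (i : Fin n)) := by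
      ext ⟨i, hi⟩ ⟨j, hj⟩
      simp [toSquareBlockProp, ABmat, hj]
    have h3 (inst : Fintype B) :
        (-M.submatrix (fun i : B => (i : Fin n)) (fun i : B => (i : Fin n))).det =
          (-1) ^ B.card * (M.submatrix (fun i : B => (i : Fin n)) (fun i : B => (i : Fin n))).det := by
      rw [det_neg, Fintype.card_of_subtype B fun _ => Iff.rfl]
    rw [h1, h2, det_one, mul_one, h3, ← mul_assoc, ← mul_pow]
    norm_num
    rcases B.eq_empty_or_nonempty with rfl | hB
    · simp
    · convert hM B hB
  · intro i hi j hj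
    simp only [ABmat, if_neg hj]
    rw [if_neg]
    rintro rfl
    exact hj hi

/-- The determinant of `A_B` with column `i` replaced by `q`, times `(-1)^|B|`, as a polynomial
in the entries of `M` and `q`. -/
noncomputable def cramerPoly {n : ℕ} (B : Finset (Fin n)) (i : Fin n) :
    MvPolynomial (Fin n × Fin n ⊕ Fin n) ℝ :=
  C ((-1) ^ B.card) *
    (Matrix.updateCol (Matrix.of fun r s : Fin n =>
        if s ∈ B then -X (Sum.inl (r, s)) else if r = s then 1 else 0)
      i fun r => X (Sum.inr r)).det

theorem totalDegree_cramerPoly_le {n : ℕ} (B : Finset (Fin n)) (i : Fin n) :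
    (cramerPoly B i).totalDegree ≤ n := by
  refine (totalDegree_mul _ _).trans ?_
  rw [totalDegree_C, zero_add]
  refine totalDegree_det_le _ fun r s => ?_
  rw [updateCol_apply]
  split_ifs
  · exact (totalDegree_X _).le
  · rw [of_apply]
    split_ifs <;> simp

/-- The point with coordinates the entries of `M` and `q`. -/
def lcpPoint {n : ℕ} (M : Matrix (Fin n) (Fin n) ℝ) (q : Fin n → ℝ) :
    Fin n × Fin n ⊕ Fin n → ℝ :=
  Sum.elim (fun a => M a.1 a.2) q

theorem eval_cramerPoly {n : ℕ} {M : Matrix (Fin n) (Fin n) ℝ} (hM : IsPMatrix M)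
    (q : Fin n → ℝ) (B : Finset (Fin n)) (i : Fin n) :
    eval (lcpPoint M q) (cramerPoly B i) =
      ((-1) ^ B.card * (ABmat M B).det) * lcpVal M q B i := by
  have hdet : (ABmat M B).det ≠ 0 := right_ne_zero_of_mul (hM.det_ABmat_pos B).ne'
  have h1 : (ABmat M B).det * lcpVal M q B i = (ABmat M B).cramer q i := by
    rw [lcpVal, inv_def, Ring.inverse_eq_inv', smul_mulVec, ← cramer_eq_adjugate_mulVec,
      Pi.smul_apply, smul_eq_mul, mul_inv_cancel_left₀ hdet]
  rw [mul_assoc, h1, cramer_apply, cramerPoly, map_mul, eval_C, RingHom.map_det]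
  congr 2
  ext r s
  simp only [RingHom.mapMatrix_apply, map_apply, updateCol_apply, of_apply, ABmat]
  split_ifs <;> simp [lcpPoint]

/-- The polynomial whose positivity says that the edge at `v` in direction `i` is outgoing
(`b = true`) or incoming (`b = false`). -/
noncomputable def edgePoly {n : ℕ} (j : Vertex n × Fin n × Bool) :
    MvPolynomial (Fin n × Fin n ⊕ Fin n) ℝ :=
  if j.2.2 then -cramerPoly (vertexBasis j.1) j.2.1 else cramerPoly (vertexBasis j.1) j.2.1

theorem card_isPUSO_le (n : ℕ) (hn : 1 ≤ n) :
    Nat.card {φ : CubeOrientation n // IsPUSO φ} ≤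
      (∑ k ∈ Finset.range (n ^ 2 + n + 1), (2 ^ n * (n * 2)).choose k) *
        (2 * n) ^ (n ^ 2 + n) := by
  classical
  have h := card_le_of_disjoint_positivity (W := {φ : CubeOrientation n // IsPUSO φ})
    (edgePoly (n := n)) hn
    (fun j => by
      unfold edgePoly
      split_ifs
      · rw [totalDegree_neg]; exact totalDegree_cramerPoly_le _ _
      · exact totalDegree_cramerPoly_le _ _)
    (fun φ => Finset.univ.filter fun j => φ.1 j.1 j.2.1 = j.2.2) ?_ ?_
  · rw [Nat.card_eq_fintype_card]
    simpa [sq] using h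
  · rintro ⟨φ, M, q, hM, hq, rfl⟩
    refine ⟨lcpPoint M q, ?_⟩
    rintro ⟨v, i, b⟩ hj
    have hpos := hM.det_ABmat_pos (vertexBasis v)
    have hne := hq (vertexBasis v) i
    replace hj : decide (lcpVal M q (vertexBasis v) i < 0) = b := (Finset.mem_filter.1 hj).2
    cases b
    · simp only [decide_eq_false_iff_not, not_lt] at hj
      simp only [edgePoly, Bool.false_eq_true, if_false, eval_cramerPoly hM]
      exact mul_pos hpos (lt_of_le_of_ne hj hne.symm)
    · simp only [decide_eq_true_eq] at hj
      simp only [edgePoly, if_true, map_neg, eval_cramerPoly hM]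
      exact neg_pos.2 (mul_neg_of_pos_of_neg hpos hj)
  · rintro ⟨φ, hφ⟩ ⟨φ', hφ'⟩ x h h'
    ext v i
    by_contra hne
    have h1 := h (v, i, φ v i) (by simp)
    have h2 := h' (v, i, φ' v i) (by simp)
    simp only at hne
    cases hb : φ v i <;> cases hb' : φ' v i <;>
      simp only [hb, hb', not_true_eq_false] at hne h1 h2 <;>
      simp only [edgePoly, Bool.false_eq_true, if_true, if_false, map_neg] at h1 h2 <;>
      linarith

theorem stmt0 (n : ℕ) (hn : 1 ≤ n) :
    (Nat.card {φ : CubeOrientation n // IsPUSO φ} : ℝ) ≤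
      (4 * Real.exp 1 * 2 ^ n) ^ (n ^ 2 + n) := by
  have hnR : (0 : ℝ) < n := by exact_mod_cast hn
  have h2n : n + 1 ≤ 2 ^ n := Nat.lt_two_pow_self
  have hle : n ^ 2 + n ≤ 2 ^ n * (n * 2) := by nlinarith
  have h1 : (Nat.card {φ : CubeOrientation n // IsPUSO φ} : ℝ) ≤
      (∑ k ∈ Finset.range (n ^ 2 + n + 1), ((2 ^ n * (n * 2)).choose k : ℝ)) *
        (2 * n) ^ (n ^ 2 + n) := by
    exact_mod_cast card_isPUSO_le n hn
  have h2 := sum_range_choose_mul_pow_le_exp hle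
  set A := ∑ k ∈ Finset.range (n ^ 2 + n + 1), ((2 ^ n * (n * 2)).choose k : ℝ)
  have hA : 0 ≤ A := by positivity
  have h3 : (2 * n : ℝ) ≤ (((n ^ 2 + n : ℕ) : ℝ) / ((2 ^ n * (n * 2) : ℕ) : ℝ)) *
      (4 * 2 ^ n) := by
    push_cast
    rw [div_mul_eq_mul_div, le_div_iff₀ (by positivity)]
    have : (0 : ℝ) < 2 ^ n * n := by positivity
    nlinarith
  calc (Nat.card {φ : CubeOrientation n // IsPUSO φ} : ℝ)
      ≤ A * (2 * n) ^ (n ^ 2 + n) := h1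
    _ ≤ A * ((((n ^ 2 + n : ℕ) : ℝ) / ((2 ^ n * (n * 2) : ℕ) : ℝ)) * (4 * 2 ^ n)) ^ (n ^ 2 + n) :=
      mul_le_mul_of_nonneg_left (pow_le_pow_left₀ (by positivity) h3 _) hA
    _ = A * (((n ^ 2 + n : ℕ) : ℝ) / ((2 ^ n * (n * 2) : ℕ) : ℝ)) ^ (n ^ 2 + n) *
        (4 * 2 ^ n) ^ (n ^ 2 + n) := by rw [mul_pow, mul_assoc]
    _ ≤ Real.exp (n ^ 2 + n : ℕ) * (4 * 2 ^ n) ^ (n ^ 2 + n) :=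
      mul_le_mul_of_nonneg_right h2 (by positivity)
    _ = (4 * Real.exp 1 * 2 ^ n) ^ (n ^ 2 + n) := by
      rw [← Real.exp_one_pow, ← mul_pow]
      congr 1
      ring
end

section
/- For every n ≥ 1, the number of distinct orientations of the n-cube that are simultaneously unique-sink orientations, acyclic, locally uniform, and strongly Holt–Klee is at least 2^{C(n−1, ⌊(n−1)/2⌋)}, where C(k,j) denotes the binomial coefficient. -/
open Matrix BigOperators

/-- The orientation with target bit `τ i` in every coordinate `i ≠ z`, and target bit `f v`
in the coordinate `z`. -/
def twist {n : ℕ} (z : Fin n) (τ : Vertex n) (f : Vertex n → Bool) : CubeOrientation n :=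
  fun v i => v i != if i = z then f v else τ i

/-- `f` ignores the coordinate `z` and is monotone or antitone in each other coordinate. -/
def Unate {n : ℕ} (z : Fin n) (f : Vertex n → Bool) : Prop :=
  ∀ c, ∃ ρ : Vertex n, ∀ v w : Vertex n,
    (∀ i, i ≠ z → v i ≠ w i → w i = ρ i) → f v = c → f w = c

theorem Unate.eq_of_agree {n : ℕ} {z : Fin n} {f : Vertex n → Bool} (hf : Unate z f)
    {v w : Vertex n} (h : ∀ i, i ≠ z → v i = w i) : f w = f v := by
  obtain ⟨ρ, hρ⟩ := hf (f v)
  exact hρ v w (fun i hi hne => absurd (h i hi) hne) rfl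

theorem Unate.not {n : ℕ} {z : Fin n} {f : Vertex n → Bool} (hf : Unate z f) :
    Unate z (fun v => !f v) := by
  intro c
  obtain ⟨ρ, hρ⟩ := hf (!c)
  refine ⟨ρ, fun v w h hv => ?_⟩
  have := hρ v w h (by simp [← hv])
  simp [this]

theorem vflip_same {n : ℕ} (v : Vertex n) (i : Fin n) : vflip v i i = !v i := by
  simp [vflip]

theorem vflip_ne {n : ℕ} (v : Vertex n) {i j : Fin n} (h : j ≠ i) : vflip v i j = v j := by
  simp [vflip, h]

theorem reorient_twist {n : ℕ} {z : Fin n} {τ : Vertex n} {f : Vertex n → Bool}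
    (hf : Unate z f) (F : Finset (Fin n)) :
    ∃ τ' f', Unate z f' ∧ Reorient (twist z τ f) F = twist z τ' f' := by
  have hz : ∀ v : Vertex n, f (vflip v z) = f v := fun v =>
    hf.eq_of_agree fun i hi => (vflip_ne v hi).symm
  by_cases hF : z ∈ F
  · refine ⟨fun i => if i ∈ F then !τ i else τ i, fun v => !f v, hf.not, ?_⟩
    funext v i
    by_cases hi : i = z
    · subst hi
      simp [Reorient, twist, hF, vflip_same, hz]
    · by_cases hiF : i ∈ F <;> simp [Reorient, twist, hi, hiF, vflip_same]
  · refine ⟨fun i => if i ∈ F then !τ i else τ i, f, hf, ?_⟩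
    funext v i
    by_cases hi : i = z
    · subst hi
      simp [Reorient, twist, hF]
    · by_cases hiF : i ∈ F <;> simp [Reorient, twist, hi, hiF, vflip_same]

theorem isUSO_twist {n : ℕ} {z : Fin n} (τ : Vertex n) {f : Vertex n → Bool}
    (hf : Unate z f) : IsUSO (twist z τ f) := by
  intro v C
  set u₀ : Vertex n := fun i => if i ∈ C then τ i else v i with hu₀
  refine ⟨fun i => if i ∈ C then (if i = z then f u₀ else τ i) else v i, ⟨?_, ?_⟩, ?_⟩
  · intro j hj
    simp [hj]
  · intro i hi
    by_cases hz : i = z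
    · subst hz
      have : f (fun j => if j ∈ C then (if j = i then f u₀ else τ j) else v j) = f u₀ :=
        hf.eq_of_agree fun j hj => by simp [hu₀, hj]
      simp [twist, hi, this]
    · simp [twist, hi, hz]
  · rintro w ⟨hw, hw'⟩
    have hne : ∀ i ∈ C, i ≠ z → w i = τ i := fun i hi hz => by
      simpa [twist, hz] using hw' i hi
    have hfw : f w = f u₀ := hf.eq_of_agree fun i hi => by
      by_cases hC : i ∈ C
      · simp [hu₀, hC, hne i hC hi]
      · simp [hu₀, hC, hw i hC]
    funext i
    by_cases hC : i ∈ C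
    · by_cases hz : i = z
      · subst hz
        have := hw' i hC
        simp only [twist, if_true] at this
        simp only [hC, if_true]
        simpa [hfw] using this
      · simp [hC, hz, hne i hC hz]
    · simp [hC, hw i hC]

/-- A potential that increases along the edges of `twist z τ f`. -/
def twistRank {n : ℕ} (z : Fin n) (τ : Vertex n) (f : Vertex n → Bool) (v : Vertex n) : ℕ :=
  2 * (Finset.univ.filter (fun i => i ≠ z ∧ v i = τ i)).card + if v z = f v then 1 else 0

theorem twistRank_lt {n : ℕ} {z : Fin n} {τ : Vertex n} {f : Vertex n → Bool}
    (hf : Unate z f) {u w : Vertex n} (h : OrientStep (twist z τ f) u w) :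
    twistRank z τ f u < twistRank z τ f w := by
  obtain ⟨i, hi, rfl⟩ := h
  by_cases hz : i = z
  · subst hz
    have h1 : f (vflip u i) = f u := hf.eq_of_agree fun j hj => (vflip_ne u hj).symm
    have h2 : (Finset.univ.filter (fun j => j ≠ i ∧ vflip u i j = τ j)) =
        Finset.univ.filter (fun j => j ≠ i ∧ u j = τ j) := by
      apply Finset.filter_congr
      intro j _
      by_cases hj : j = i
      · simp [hj]
      · simp [hj, vflip_ne]
    have h3 : u i ≠ f u := by simpa [twist] using hi
    have h4 : vflip u i i = f u := by
      rw [vflip_same]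
      revert h3
      cases u i <;> cases f u <;> simp
    simp only [twistRank, h2, h1, h3, h4, if_true, if_false]
    omega
  · have h3 : u i ≠ τ i := by simpa [twist, hz] using hi
    have h4 : vflip u i i = τ i := by
      rw [vflip_same]
      revert h3
      cases u i <;> cases τ i <;> simp
    have h5 : (Finset.univ.filter (fun j => j ≠ z ∧ u j = τ j)).card <
        (Finset.univ.filter (fun j => j ≠ z ∧ vflip u i j = τ j)).card := by
      apply Finset.card_lt_card
      rw [Finset.ssubset_iff_of_subset]
      · exact ⟨i, by simp [hz, h4], by simp [h3]⟩
      · intro j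
        simp only [Finset.mem_filter, Finset.mem_univ, true_and]
        rintro ⟨hj, hj'⟩
        have hji : j ≠ i := by
          rintro rfl
          exact h3 hj'
        exact ⟨hj, by rw [vflip_ne u hji, hj']⟩
    unfold twistRank
    split_ifs <;> omega

theorem isAcyclic_of_rank {n : ℕ} {φ : CubeOrientation n} {rk : Vertex n → ℕ}
    (h : ∀ u w, OrientStep φ u w → rk u < rk w) : IsAcyclic φ := by
  intro u hu
  have : ∀ w, Relation.TransGen (OrientStep φ) u w → rk u < rk w := by
    intro w hw
    induction hw with
    | single h1 => exact h _ _ h1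
    | tail _ h1 ih => exact ih.trans (h _ _ h1)
  exact lt_irrefl _ (this u hu)

theorem isDirPathIn_of_steps {n : ℕ} {φ : CubeOrientation n} {rk : Vertex n → ℕ}
    (hrk : ∀ u w, OrientStep φ u w → rk u < rk w) {v s t : Vertex n} {C : Finset (Fin n)}
    (g : ℕ → Vertex n) (N : ℕ) (h0 : g 0 = s) (hN : g N = t)
    (hsub : ∀ k ≤ N, InSubcube v C (g k))
    (hstep : ∀ k < N, ∃ i ∈ C, φ (g k) i = true ∧ g (k + 1) = vflip (g k) i) :
    IsDirPathIn φ v C s t ((List.range (N + 1)).map g) := by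
  have hmono : ∀ j ≤ N, ∀ k < j, rk (g k) < rk (g j) := by
    intro j
    induction j with
    | zero => intro _ k hk; omega
    | succ j ih =>
      intro hj k hk
      obtain ⟨i, -, hi, hi'⟩ := hstep j (by omega)
      have h1 := hrk _ _ ⟨i, hi, hi'⟩
      rcases Nat.lt_succ_iff_lt_or_eq.mp hk with h | rfl
      · exact (ih (by omega) k h).trans h1
      · exact h1
  refine ⟨?_, ?_, ?_, ?_, ?_⟩
  · simp [List.range_succ_eq_map, h0]
  · simp [List.range_succ, hN]
  · refine List.Nodup.map_on ?_ List.nodup_range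
    intro x hx y hy hxy
    simp only [List.mem_range] at hx hy
    rcases lt_trichotomy x y with h | h | h
    · exact absurd (hmono y (by omega) x h) (by simp [hxy])
    · exact h
    · exact absurd (hmono x (by omega) y h) (by simp [hxy])
  · intro u hu
    simp only [List.mem_map, List.mem_range] at hu
    obtain ⟨k, hk, rfl⟩ := hu
    exact hsub k (by omega)
  · refine List.isChain_iff_getElem.2 ?_
    intro k hk
    simp only [List.length_map, List.length_range] at hk
    simpa using hstep k (by omega)

/-- The cyclic distance from `r` forward to `x` in `{0, …, m - 1}`. -/
def cyc (m r x : ℕ) : ℕ := if r ≤ x then x - r else x + m - r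

/-- `idx` and `e` are mutually inverse enumerations of `D` by `{0, …, m - 1}`. -/
structure IsEnum {n : ℕ} (D : Finset (Fin n)) (m : ℕ) (idx : Fin n → ℕ) (e : ℕ → Fin n) :
    Prop where
  idx_lt : ∀ i ∈ D, idx i < m
  e_idx : ∀ i ∈ D, e (idx i) = i
  e_mem : ∀ j < m, e j ∈ D
  idx_e : ∀ j < m, idx (e j) = j

theorem exists_isEnum {n : ℕ} (z : Fin n) (D : Finset (Fin n)) (A : Fin n → Prop)
    [DecidablePred A] :
    ∃ idx e a, IsEnum D D.card idx e ∧ ∀ i ∈ D, A i ↔ idx i < a := by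
  set LA := (D.filter A).toList with hLA
  set LB := (D.filter (fun i => ¬ A i)).toList with hLB
  have hnd : (LA ++ LB).Nodup := by
    rw [List.nodup_append]
    refine ⟨Finset.nodup_toList _, Finset.nodup_toList _, ?_⟩
    intro x hx y hy
    simp only [hLA, hLB, Finset.mem_toList, Finset.mem_filter] at hx hy
    rintro rfl
    exact hy.2 hx.2
  have hmem : ∀ i, i ∈ LA ++ LB ↔ i ∈ D := by
    intro i
    simp only [hLA, hLB, List.mem_append, Finset.mem_toList, Finset.mem_filter]
    tauto
  have hlen : (LA ++ LB).length = D.card := by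
    rw [List.length_append, Finset.length_toList, Finset.length_toList,
      Finset.card_filter_add_card_filter_not]
  refine ⟨fun i => (LA ++ LB).idxOf i, fun j => (LA ++ LB).getD j z, LA.length,
    ⟨?_, ?_, ?_, ?_⟩, ?_⟩
  · intro i hi
    rw [← hlen]
    exact List.idxOf_lt_length_of_mem ((hmem i).2 hi)
  · intro i hi
    have := List.idxOf_lt_length_of_mem ((hmem i).2 hi)
    simp only [List.getD_eq_getElem _ _ this, List.getElem_idxOf]
  · intro j hj
    rw [← hlen] at hj
    simp only [List.getD_eq_getElem _ _ hj]
    exact (hmem _).1 (List.getElem_mem hj)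
  · intro j hj
    rw [← hlen] at hj
    simp only [List.getD_eq_getElem _ _ hj]
    exact hnd.idxOf_getElem j hj
  · intro i hi
    have hA : A i ↔ i ∈ LA := by simp [hLA, hi]
    rw [hA]
    simp only [List.idxOf_append]
    split_ifs with h
    · simpa [h] using List.idxOf_lt_length_of_mem h
    · simp [h]

/-- The vertex that agrees with `t` on the cyclic interval of length `j` from `r` in `D`, and
with `s` elsewhere, except that its bit `z` is `b`. -/
def arcPt {n : ℕ} (z : Fin n) (D : Finset (Fin n)) (m : ℕ) (idx : Fin n → ℕ)
    (s t : Vertex n) (r j : ℕ) (b : Bool) : Vertex n :=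
  fun i => if i = z then b else if i ∈ D ∧ cyc m r (idx i) < j then t i else s i

section ArcPt

variable {n : ℕ} {z : Fin n} {D : Finset (Fin n)} {m : ℕ} {idx : Fin n → ℕ} {e : ℕ → Fin n}
  {s t : Vertex n}

theorem arcPt_zero (r : ℕ) : arcPt z D m idx s t r 0 (s z) = s := by
  funext i
  by_cases h : i = z
  · simp [arcPt, h]
  · simp [arcPt, h]

theorem arcPt_full_of_ne (hE : IsEnum D m idx e) (hst : ∀ i, i ≠ z → i ∉ D → s i = t i)
    {r : ℕ} (hr : r ≤ m) {j : ℕ} (hj : m ≤ j) (b : Bool) {i : Fin n} (hi : i ≠ z) :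
    arcPt z D m idx s t r j b i = t i := by
  by_cases hD : i ∈ D
  · have h1 := hE.idx_lt i hD
    have h2 : cyc m r (idx i) < j := by
      unfold cyc
      split_ifs <;> omega
    simp [arcPt, hi, hD, h2]
  · simp [arcPt, hi, hD, hst i hi hD]

theorem arcPt_full (hE : IsEnum D m idx e) (hst : ∀ i, i ≠ z → i ∉ D → s i = t i)
    {r : ℕ} (hr : r ≤ m) {j : ℕ} (hj : m ≤ j) : arcPt z D m idx s t r j (t z) = t := by
  funext i
  by_cases hi : i = z
  · simp [arcPt, hi]
  · exact arcPt_full_of_ne hE hst hr hj _ hi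

theorem arcPt_vflip_z (r j : ℕ) (b : Bool) :
    arcPt z D m idx s t r j (!b) = vflip (arcPt z D m idx s t r j b) z := by
  funext i
  by_cases hi : i = z
  · subst hi
    simp [vflip_same, arcPt]
  · rw [vflip_ne _ hi]
    simp [arcPt, hi]

theorem exists_arcPt_succ (hE : IsEnum D m idx e) (hz : z ∉ D)
    (hst : ∀ i ∈ D, t i = !s i) {r j : ℕ} (hr : r < m) (hj : j < m) (b : Bool) :
    ∃ i ∈ D, arcPt z D m idx s t r j b i = s i ∧
      arcPt z D m idx s t r (j + 1) b = vflip (arcPt z D m idx s t r j b) i := by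
  obtain ⟨x, hx, hxj⟩ : ∃ x < m, cyc m r x = j := by
    by_cases h : r + j < m
    · exact ⟨r + j, h, by unfold cyc; split_ifs <;> omega⟩
    · exact ⟨r + j - m, by omega, by unfold cyc; split_ifs <;> omega⟩
  have hD := hE.e_mem x hx
  have hne : e x ≠ z := fun h => hz (h ▸ hD)
  have hs : arcPt z D m idx s t r j b (e x) = s (e x) := by
    simp [arcPt, hne, hE.idx_e x hx, hxj]
  refine ⟨e x, hD, hs, ?_⟩
  funext i
  by_cases hi : i = e x
  · subst hi
    rw [vflip_same, hs]
    simp [arcPt, hne, hD, hE.idx_e x hx, hxj, hst _ hD]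
  · rw [vflip_ne _ hi]
    by_cases hiD : i ∈ D
    · have h1 := hE.idx_lt i hiD
      have h2 : idx i ≠ x := by
        rintro rfl
        exact hi (hE.e_idx i hiD).symm
      have h3 : cyc m r (idx i) < j + 1 ↔ cyc m r (idx i) < j := by
        unfold cyc at *
        split_ifs at * <;> omega
      simp only [arcPt, h3]
    · simp [arcPt, hiD]

theorem arcPt_eq (hE : IsEnum D m idx e) (hz : z ∉ D) (hst : ∀ i ∈ D, t i = !s i)
    {r j r' j' : ℕ} {b b' : Bool} (hr : r < m) (hr' : r' < m) (hj : j ≤ m) (hj' : j' ≤ m)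
    (h : arcPt z D m idx s t r j b = arcPt z D m idx s t r' j' b') :
    b = b' ∧ (r = r' ∨ j = 0 ∧ j' = 0 ∨ j = m ∧ j' = m) := by
  have hb : b = b' := by simpa [arcPt] using congrFun h z
  have key : ∀ x < m, (cyc m r x < j ↔ cyc m r' x < j') := by
    intro x hx
    have hD := hE.e_mem x hx
    have hne : e x ≠ z := fun h => hz (h ▸ hD)
    have := congrFun h (e x)
    simp only [arcPt, hne, if_false, hD, true_and, hE.idx_e x hx, hst _ hD] at this
    by_cases h1 : cyc m r x < j <;> by_cases h2 : cyc m r' x < j' <;> simp_all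
    omega
  have pred : ∀ r < m, ∀ r' < m, r ≠ r' → ∃ x < m, cyc m r x = m - 1 ∧
      cyc m r' x + 1 = cyc m r' r := by
    intro r hr r' hr' hne
    refine ⟨if r = 0 then m - 1 else r - 1, by split_ifs <;> omega, ?_, ?_⟩ <;>
      unfold cyc <;> split_ifs <;> omega
  have self : ∀ r, cyc m r r = 0 := fun r => by simp [cyc]
  refine ⟨hb, ?_⟩
  by_cases hrr : r = r'
  · exact Or.inl hrr
  · obtain ⟨x, hx, h1, h2⟩ := pred r hr r' hr' hrr
    obtain ⟨y, hy, h3, h4⟩ := pred r' hr' r hr (Ne.symm hrr)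
    have k1 := key r hr
    have k2 := key r' hr'
    have k3 := key x hx
    have k4 := key y hy
    rw [self] at k1 k2
    omega

end ArcPt

theorem isDirPathIn_arcPath {n : ℕ} {z : Fin n} {τ : Vertex n} {f : Vertex n → Bool}
    (hf : Unate z f) {C : Finset (Fin n)} {v s t : Vertex n} {m : ℕ} {idx : Fin n → ℕ}
    {e : ℕ → Fin n} (hE : IsEnum (C.erase z) m idx e)
    (hs : IsSource (twist z τ f) v C s) (ht : IsSink (twist z τ f) v C t)
    {r : ℕ} (hr : r ≤ m) (h : ℕ → ℕ) (lev : ℕ → Bool) (N : ℕ)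
    (h0 : h 0 = 0) (hN : h N = m) (l0 : lev 0 = s z) (lN : lev N = t z)
    (hstep : ∀ k < N, (h (k + 1) = h k + 1 ∧ h k < m ∧ r < m ∧ lev (k + 1) = lev k) ∨
      (h (k + 1) = h k ∧ lev (k + 1) = (!lev k) ∧ z ∈ C ∧
        f (arcPt z (C.erase z) m idx s t r (h k) (lev k)) = !lev k)) :
    IsDirPathIn (twist z τ f) v C s t ((List.range (N + 1)).map
      fun k => arcPt z (C.erase z) m idx s t r (h k) (lev k)) := by
  have hsC : ∀ i ∈ C.erase z, s i = !τ i := by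
    intro i hi
    obtain ⟨hi, hiC⟩ := Finset.mem_erase.1 hi
    have := hs.2 i hiC
    simp only [twist, hi, if_false] at this
    revert this
    cases s i <;> cases τ i <;> simp
  have htC : ∀ i ∈ C.erase z, t i = !s i := by
    intro i hi
    rw [hsC i hi]
    obtain ⟨hi, hiC⟩ := Finset.mem_erase.1 hi
    simpa [twist, hi] using ht.2 i hiC
  have hst : ∀ i, i ≠ z → i ∉ C.erase z → s i = t i := by
    intro i hi hiC
    have hiC : i ∉ C := fun h => hiC (Finset.mem_erase.2 ⟨hi, h⟩)
    rw [hs.1 i hiC, ht.1 i hiC]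
  have hlev : z ∉ C → ∀ k ≤ N, lev k = s z := by
    intro hz k
    induction k with
    | zero => intro _; exact l0
    | succ k ih =>
      intro hk
      rcases hstep k (by omega) with h | h
      · rw [h.2.2.2, ih (by omega)]
      · exact absurd h.2.2.1 hz
  refine isDirPathIn_of_steps (fun u w => twistRank_lt hf) _ N ?_ ?_ ?_ ?_
  · simp only [h0, l0, arcPt_zero]
  · simp only [hN, lN]
    exact arcPt_full hE hst hr le_rfl
  · intro k hk i hi
    by_cases hz : i = z
    · subst hz
      simp [arcPt, hlev hi k hk, hs.1 i hi]
    · simp [arcPt, hz, hi, hs.1 i hi]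
  · intro k hk
    rcases hstep k hk with ⟨h1, h2, h3, h4⟩ | ⟨h1, h2, h3, h4⟩
    · obtain ⟨i, hi, hi1, hi2⟩ :=
        exists_arcPt_succ hE (Finset.notMem_erase z C) htC h3 h2 (lev k)
      refine ⟨i, Finset.mem_of_mem_erase hi, ?_, ?_⟩
      · simp only [twist, Finset.ne_of_mem_erase hi, if_false, hi1, hsC i hi]
        cases τ i <;> rfl
      · simp only [h1, h4, hi2]
    · refine ⟨z, h3, ?_, ?_⟩
      · simp only [twist, if_true, h4]
        simp [arcPt]
      · simp only [h1, h2, arcPt_vflip_z]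

/-- In a subcube whose source and sink have the same preferred `z`-bit, one can order the
other coordinates cyclically so that all cyclic intervals starting at a given point, with one
exception, pass through a vertex at which the path may change its `z`-bit. -/
theorem exists_crossings {n : ℕ} {z : Fin n} {f : Vertex n → Bool} (hf : Unate z f)
    (D : Finset (Fin n)) {s t : Vertex n} (hD : ∀ i ∈ D, t i = !s i)
    (hst : ∀ i, i ≠ z → i ∉ D → s i = t i) (hfst : f s = f t) :
    ∃ idx e r₀, ∃ p : ℕ → ℕ, IsEnum D D.card idx e ∧ (r₀ ≤ D.card) ∧
      (0 < D.card → r₀ < D.card) ∧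
      ∀ r < D.card, r ≠ r₀ → 0 < p r ∧ p r < D.card ∧
        ∀ b, f (arcPt z D D.card idx s t r (p r) b) = f s := by
  obtain ⟨ρ, hρ⟩ := hf (f s)
  obtain ⟨idx, e, a, hE, hA⟩ := exists_isEnum z D (fun i => t i = ρ i)
  refine ⟨idx, e, if a < D.card then a else 0, fun r => if r < a then 1 else D.card - 1, hE,
    ?_, ?_, ?_⟩
  · split_ifs <;> omega
  · split_ifs <;> omega
  · intro r hr hr0
    have hm : 2 ≤ D.card ∧ (a ≤ r → a < r) := by
      split_ifs at hr0 <;> omega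
    by_cases hra : r < a
    · simp only [hra, if_true]
      refine ⟨by omega, by omega, fun b => hρ s _ ?_ rfl⟩
      intro i hi hne
      by_cases hc : i ∈ D ∧ cyc D.card r (idx i) < 1
      · simp only [arcPt, hi, if_false, hc, and_self, if_true]
        have h1 := hE.idx_lt i hc.1
        have h2 := hc.2
        refine (hA i hc.1).2 ?_
        unfold cyc at h2
        split_ifs at h2 <;> omega
      · exact absurd (by simp only [arcPt, hi, if_false, hc]) hne
    · simp only [hra, if_false]
      refine ⟨by omega, by omega, fun b => hρ t _ ?_ hfst.symm⟩
      intro i hi hne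
      by_cases hiD : i ∈ D
      · by_cases hc : cyc D.card r (idx i) < D.card - 1
        · simp [arcPt, hi, hc, hiD] at hne
        · have h1 := hE.idx_lt i hiD
          have h2 : ¬ idx i < a := by
            unfold cyc at hc
            split_ifs at hc <;> omega
          have h3 : t i ≠ ρ i := fun h => h2 ((hA i hiD).1 h)
          simp only [arcPt, hi, if_false, hc, and_false]
          rw [hD i hiD] at h3
          revert h3
          cases s i <;> cases ρ i <;> simp
      · simp [arcPt, hi, hiD, hst i hi hiD] at hne

theorem arcPt_main_disjoint {n : ℕ} {z : Fin n} {D : Finset (Fin n)} {m : ℕ}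
    {idx : Fin n → ℕ} {e : ℕ → Fin n} {s t : Vertex n} (hE : IsEnum D m idx e) (hz : z ∉ D)
    (hD : ∀ i ∈ D, t i = !s i) (hst : ∀ i, i ≠ z → i ∉ D → s i = t i) (hzz : t z = s z)
    {r j r' j' : ℕ} (hr : r < m) (hr' : r' < m) (hrr : r ≠ r') (hj : j ≤ m) (hj' : j' ≤ m)
    (h : arcPt z D m idx s t r j (s z) = arcPt z D m idx s t r' j' (s z)) :
    arcPt z D m idx s t r j (s z) = s ∨ arcPt z D m idx s t r j (s z) = t := by
  rcases (arcPt_eq hE hz hD hr hr' hj hj' h).2 with h | h | h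
  · exact absurd h hrr
  · left
    rw [h.1, arcPt_zero]
  · right
    rw [h.1, ← hzz]
    exact arcPt_full hE hst hr.le le_rfl

theorem holtKlee_twist {n : ℕ} {z : Fin n} (τ : Vertex n) {f : Vertex n → Bool}
    (hf : Unate z f) : HoltKlee (twist z τ f) := by
  refine ⟨isUSO_twist τ hf, fun v C s t hs ht => ?_⟩
  set D := C.erase z with hDdef
  have hzD : z ∉ D := Finset.notMem_erase z C
  have hD : ∀ i ∈ D, t i = !s i := by
    intro i hi
    obtain ⟨hi, hiC⟩ := Finset.mem_erase.1 hi
    have h1 := hs.2 i hiC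
    have h2 := ht.2 i hiC
    simp only [twist, hi, if_false] at h1 h2
    revert h1 h2
    cases s i <;> cases t i <;> cases τ i <;> simp
  have hst : ∀ i, i ≠ z → i ∉ D → s i = t i := by
    intro i hi hiC
    have hiC : i ∉ C := fun h => hiC (Finset.mem_erase.2 ⟨hi, h⟩)
    rw [hs.1 i hiC, ht.1 i hiC]
  by_cases hzC : z ∈ C
  · have hcard : C.card = D.card + 1 := (Finset.card_erase_add_one hzC).symm
    have hsz : s z = !f s := by
      have := hs.2 z hzC
      simp only [twist, if_true] at this
      revert this
      cases s z <;> cases f s <;> simp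
    have htz : t z = f t := by simpa [twist] using ht.2 z hzC
    by_cases hfst : f s = f t
    · obtain ⟨idx, e, r₀, p, hE, hr₀, hr₀', hp⟩ := exists_crossings hf D hD hst hfst
      have htz' : t z = !s z := by simp [htz, hsz, hfst]
      have hcross : ∀ r b, r ≤ D.card →
          f (arcPt z D D.card idx s t r D.card b) = f s := fun r b hr => by
        rw [hfst]
        exact hf.eq_of_agree fun i hi => (arcPt_full_of_ne hE hst hr le_rfl b hi).symm
      have hcross0 : ∀ r b, f (arcPt z D D.card idx s t r 0 b) = f s := fun r b =>
        hf.eq_of_agree fun i hi => by simp [arcPt, hi]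
      set q : ℕ → ℕ := fun r => if D.card ≤ r then 0 else if r = r₀ then D.card else p r with hq
      set st : ℕ → ℕ := fun r => if D.card ≤ r then r₀ else r with hstart
      have hst_le : ∀ r, st r ≤ D.card := fun r => by
        simp only [hstart]; split_ifs <;> omega
      have hst_lt : 0 < D.card → ∀ r, st r < D.card := fun h r => by
        simp only [hstart]
        split_ifs
        · exact hr₀' h
        · omega
      have hq_le : ∀ r, q r ≤ D.card := fun r => by
        simp only [hq]
        split_ifs with h1 h2
        · omega
        · omega
        · exact (hp r (by omega) h2).2.1.le
      have hqf : ∀ r b, f (arcPt z D D.card idx s t (st r) (q r) b) = f s := fun r b => by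
        simp only [hq]
        split_ifs with h1 h2
        · exact hcross0 _ _
        · exact hcross _ _ (hst_le r)
        · simp only [hstart, h1, if_false]
          exact (hp r (by omega) h2).2.2 b
      refine ⟨fun k => (List.range (D.card + 1 + 1)).map fun j =>
        arcPt z D D.card idx s t (st k) (if j ≤ q k then j else j - 1)
          (if j ≤ q k then s z else !s z), fun k => ?_, ?_⟩
      · have hqk := hq_le k
        refine isDirPathIn_arcPath hf hE hs ht (hst_le k) (fun j => if j ≤ q k then j else j - 1)
          (fun j => if j ≤ q k then s z else !s z) (D.card + 1) ?_ ?_ ?_ ?_ ?_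
        · simp
        · split_ifs <;> omega
        · simp
        · rw [if_neg (by omega), htz']
        · intro j hj
          rcases lt_trichotomy j (q k) with h | h | h
          · left
            have h1 : j + 1 ≤ q k := h
            simp only [h1, h.le, if_true, and_true]
            exact ⟨trivial, by omega, hst_lt (by omega) k⟩
          · right
            subst h
            simp only [le_refl, if_true, show ¬ (q k + 1 ≤ q k) by omega, if_false]
            refine ⟨by omega, trivial, hzC, ?_⟩
            rw [hqf, hsz, Bool.not_not]
          · left
            have h1 : ¬ j + 1 ≤ q k := by omega
            have h2 : ¬ j ≤ q k := by omega
            simp only [h1, h2, if_false, and_true]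
            exact ⟨by omega, by omega, hst_lt (by omega) k⟩
      · intro k l hkl u hk hl
        simp only [List.mem_map, List.mem_range] at hk hl
        obtain ⟨i, hi, rfl⟩ := hk
        obtain ⟨j, hj, hij⟩ := hl
        have hkl' : (k : ℕ) ≠ l := fun h => hkl (Fin.ext h)
        have hk := k.2
        have hl := l.2
        have hqk := hq_le k
        have hql := hq_le l
        have hpos : 0 < D.card := by omega
        have key := arcPt_eq hE hzD hD (hst_lt hpos l) (hst_lt hpos k)
          (by split_ifs <;> omega) (by split_ifs <;> omega) hij
        have hlev : i ≤ q k ↔ j ≤ q l := by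
          have := key.1
          constructor
          · intro h1
            by_contra h2
            simp [h1, h2] at this
          · intro h1
            by_contra h2
            simp [h1, h2] at this
        have hcase : ∀ r, (D.card ≤ r ∧ q r = 0 ∧ st r = r₀) ∨
            (r < D.card ∧ r = r₀ ∧ q r = D.card ∧ st r = r) ∨
            (r < D.card ∧ r ≠ r₀ ∧ 0 < q r ∧ q r < D.card ∧ st r = r) := by
          intro r
          by_cases h1 : D.card ≤ r
          · simp [hq, hstart, h1]
          · by_cases h2 : r = r₀
            · subst h2
              simp [hq, hstart, h1, Nat.lt_of_not_le h1]
            · have := hp r (by omega) h2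
              simp [hq, hstart, h1, h2, Nat.lt_of_not_le h1, this]
        have hends : (i = 0 ∨ i = D.card + 1) ∨ (j = 0 ∨ j = D.card + 1) := by
          have key2 := key.2
          clear key hij hqf hp hq hstart
          have c1 := hcase k
          have c2 := hcase l
          split_ifs at key2 <;> omega
        have hend : ∀ r i, (i = 0 ∨ i = D.card + 1) →
            (arcPt z D D.card idx s t (st r) (if i ≤ q r then i else i - 1)
              (if i ≤ q r then s z else !s z) = s ∨
            arcPt z D D.card idx s t (st r) (if i ≤ q r then i else i - 1)
              (if i ≤ q r then s z else !s z) = t) := by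
          rintro r i (rfl | rfl)
          · left
            simp only [Nat.zero_le, if_true, arcPt_zero]
          · right
            have := hq_le r
            rw [if_neg (by omega), if_neg (by omega), ← htz']
            exact arcPt_full hE hst (hst_le r) (by omega)
        rcases hends with h | h
        · exact hend k i h
        · have := hend l j h
          rwa [hij] at this
    · obtain ⟨idx, e, -, hE, -⟩ := exists_isEnum z D (fun _ => True)
      have hpos : 0 < D.card := by
        rw [Finset.card_pos, Finset.nonempty_iff_ne_empty]
        intro h
        exact hfst (hf.eq_of_agree fun i hi => (hst i hi (by simp [h])).symm)
      have hzz : t z = s z := by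
        rw [htz, hsz]
        revert hfst
        cases f s <;> cases f t <;> simp
      refine ⟨fun k => if (k : ℕ) < D.card then (List.range (D.card + 1)).map fun j =>
          arcPt z D D.card idx s t k j (s z) else (List.range (D.card + 2 + 1)).map fun j =>
          arcPt z D D.card idx s t 0 (if j = D.card + 2 then D.card else j - 1)
            (if j = 0 ∨ j = D.card + 2 then s z else !s z), fun k => ?_, ?_⟩
      · dsimp only
        split_ifs with hk
        · refine isDirPathIn_arcPath hf hE hs ht hk.le (fun j => j) (fun _ => s z) D.card
            rfl rfl rfl hzz.symm fun j hj => Or.inl ⟨rfl, hj, hk, rfl⟩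
        · refine isDirPathIn_arcPath hf hE hs ht (Nat.zero_le _)
            (fun j => if j = D.card + 2 then D.card else j - 1)
            (fun j => if j = 0 ∨ j = D.card + 2 then s z else !s z) (D.card + 2)
            (by simp) (by simp) (by simp) (by simp [hzz]) ?_
          intro j hj
          by_cases h0 : j = 0
          · right
            subst h0
            refine ⟨by simp, by simp, hzC, ?_⟩
            have : f (arcPt z D D.card idx s t 0 0 (s z)) = f s := by rw [arcPt_zero]
            simpa [hsz] using this
          · by_cases h1 : j = D.card + 1
            · right
              subst h1
              refine ⟨by simp, by simp, hzC, ?_⟩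
              have : f (arcPt z D D.card idx s t 0 D.card (!s z)) = f t :=
                hf.eq_of_agree fun i hi =>
                  (arcPt_full_of_ne hE hst (Nat.zero_le _) le_rfl _ hi).symm
              simpa [← hzz, htz] using this
            · left
              have h2 : ¬ j = D.card + 2 := by omega
              simp only [h0, h2, if_false, or_self, Nat.add_eq_zero_iff, one_ne_zero,
                and_false, show ¬ j + 1 = D.card + 2 by omega,
                and_true]
              omega
      · have main_extra : ∀ r < D.card, ∀ i ≤ D.card, ∀ j ≤ D.card + 2,
            arcPt z D D.card idx s t r i (s z) =
              arcPt z D D.card idx s t 0 (if j = D.card + 2 then D.card else j - 1)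
                (if j = 0 ∨ j = D.card + 2 then s z else !s z) →
            arcPt z D D.card idx s t r i (s z) = s ∨ arcPt z D D.card idx s t r i (s z) = t := by
          intro r hr i hi j hj h
          have h1 := (arcPt_eq hE hzD hD hr hpos hi (by split_ifs <;> omega) h).1
          have h2 : j = 0 ∨ j = D.card + 2 := by
            by_contra hc
            simp [hc] at h1
          rw [h]
          rcases h2 with rfl | rfl
          · left
            simp [arcPt_zero]
          · right
            simpa [← hzz] using arcPt_full hE hst (Nat.zero_le _) le_rfl
        intro k l hkl u hk hl
        have hkl' : (k : ℕ) ≠ l := fun h => hkl (Fin.ext h)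
        have hk' := k.2
        have hl' := l.2
        dsimp only at hk hl
        split_ifs at hk hl with h1 h2 h2
        · simp only [List.mem_map, List.mem_range] at hk hl
          obtain ⟨i, hi, rfl⟩ := hk
          obtain ⟨j, hj, hij⟩ := hl
          exact arcPt_main_disjoint hE hzD hD hst hzz h1 h2 hkl' (by omega) (by omega) hij.symm
        · simp only [List.mem_map, List.mem_range] at hk hl
          obtain ⟨i, hi, rfl⟩ := hk
          obtain ⟨j, hj, hij⟩ := hl
          exact main_extra k h1 i (by omega) j (by omega) hij.symm
        · simp only [List.mem_map, List.mem_range] at hk hl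
          obtain ⟨i, hi, rfl⟩ := hl
          obtain ⟨j, hj, hij⟩ := hk
          exact main_extra l h2 i (by omega) j (by omega) hij.symm
        · omega
  · obtain ⟨idx, e, -, hE, -⟩ := exists_isEnum z D (fun _ => True)
    have hcard : C.card = D.card := by rw [hDdef, Finset.erase_eq_of_notMem hzC]
    have hzz : t z = s z := by rw [hs.1 z hzC, ht.1 z hzC]
    refine ⟨fun k => (List.range (D.card + 1)).map fun j =>
        arcPt z D D.card idx s t k j (s z), fun k => ?_, ?_⟩
    · have hk : (k : ℕ) < D.card := hcard ▸ k.2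
      exact isDirPathIn_arcPath hf hE hs ht hk.le (fun j => j) (fun _ => s z) D.card
        rfl rfl rfl hzz.symm fun j hj => Or.inl ⟨rfl, hj, hk, rfl⟩
    · intro k l hkl u hk hl
      have hkl' : (k : ℕ) ≠ l := fun h => hkl (Fin.ext h)
      simp only [List.mem_map, List.mem_range] at hk hl
      obtain ⟨i, hi, rfl⟩ := hk
      obtain ⟨j, hj, hij⟩ := hl
      exact arcPt_main_disjoint hE hzD hD hst hzz (hcard ▸ k.2) (hcard ▸ l.2) hkl' (by omega)
        (by omega) hij.symm

theorem stronglyHoltKlee_twist {n : ℕ} {z : Fin n} (τ : Vertex n) {f : Vertex n → Bool}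
    (hf : Unate z f) : StronglyHoltKlee (twist z τ f) := by
  intro F
  obtain ⟨τ', f', hf', h⟩ := reorient_twist (τ := τ) hf F
  rw [h]
  exact holtKlee_twist τ' hf'

theorem unate_of_monotone {n : ℕ} {z : Fin n} {f : Vertex n → Bool}
    (hf : ∀ v w : Vertex n, (∀ i, i ≠ z → v i = true → w i = true) → f v = true → f w = true) :
    Unate z f := by
  intro c
  refine ⟨fun _ => c, fun v w h hv => ?_⟩
  cases c
  · by_contra hw
    have := hf w v (fun i hi hwi => ?_) (by simpa using hw)
    · simp [hv] at this
    · by_contra hvi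
      have := h i hi (by simp_all)
      simp [hwi] at this
  · refine hf v w (fun i hi hvi => ?_) hv
    by_contra hwi
    exact hwi (h i hi (by simp_all))

theorem locallyUniform_twist {n : ℕ} {z : Fin n} {f : Vertex n → Bool}
    (hf : ∀ v w : Vertex n, (∀ i, i ≠ z → v i = true → w i = true) → f v = true → f w = true) :
    LocallyUniform (twist z (fun _ => true) f) := by
  have up : ∀ (u : Vertex n) (i j : Fin n), i ≠ j → u i = false → u j = false →
      twist z (fun _ => true) f u j = true → twist z (fun _ => true) f (vflip u i) j = true := by
    intro u i j hij hi hj h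
    simp only [twist] at *
    rw [vflip_ne u hij.symm, hj] at *
    split_ifs at * with hjz
    · have : f (vflip u i) = true := by
        refine hf u _ (fun k _ hk => ?_) (by simpa using h)
        have hki : k ≠ i := by
          rintro rfl
          simp [hi] at hk
        rw [vflip_ne u hki, hk]
      simp [this]
    · rfl
  have down : ∀ (u : Vertex n) (i : Fin n), i ≠ z → u i = false →
      twist z (fun _ => true) f (vflip u i) i = false := by
    intro u i hiz hi
    simp [twist, hiz, vflip_same, hi]
  refine ⟨fun u i j hij hi hj h1 h2 => ⟨up u i j hij hi hj h2, up u j i hij.symm hj hi h1⟩, ?_⟩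
  intro u i j hij hi hj h1 h2
  exfalso
  by_cases hiz : i = z
  · rw [down u j (fun h => hij (hiz.trans h.symm)) hj] at h2
    exact Bool.false_ne_true h2
  · rw [down u i hiz hi] at h1
    exact Bool.false_ne_true h1

/-- The monotone function whose minimal true points of size `h` are the members of `S`, and
which is true on all larger sets. -/
def layerFun {n : ℕ} (z : Fin n) (h : ℕ) (S : Finset (Finset (Fin n))) (v : Vertex n) : Bool :=
  decide (h < ((vertexBasis v).erase z).card ∨ (vertexBasis v).erase z ∈ S)

theorem layerFun_mono {n : ℕ} {z : Fin n} {h : ℕ} {S : Finset (Finset (Fin n))}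
    (hS : ∀ A ∈ S, A.card = h) (v w : Vertex n)
    (hvw : ∀ i, i ≠ z → v i = true → w i = true) (hv : layerFun z h S v = true) :
    layerFun z h S w = true := by
  simp only [layerFun, decide_eq_true_eq] at *
  have hsub : (vertexBasis v).erase z ⊆ (vertexBasis w).erase z := by
    intro i hi
    simp only [vertexBasis, Finset.mem_erase, Finset.mem_filter, Finset.mem_univ, true_and] at *
    exact ⟨hi.1, hvw i hi.1 hi.2⟩
  have hle := Finset.card_le_card hsub
  rcases hv with hv | hv
  · left; omega
  · by_cases heq : (vertexBasis v).erase z = (vertexBasis w).erase z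
    · exact Or.inr (heq ▸ hv)
    · left
      have := Finset.card_lt_card (hsub.ssubset_of_ne heq)
      rwa [hS _ hv] at this

theorem layerFun_indicator {n : ℕ} {z : Fin n} {h : ℕ} {S : Finset (Finset (Fin n))}
    {A : Finset (Fin n)} (hzA : z ∉ A) (hA : A.card = h) :
    layerFun z h S (fun i => decide (i ∈ A)) = decide (A ∈ S) := by
  have : (vertexBasis fun i => decide (i ∈ A)).erase z = A := by
    ext i
    simp only [vertexBasis, Finset.mem_erase, Finset.mem_filter, Finset.mem_univ, true_and,
      decide_eq_true_eq, and_iff_right_iff_imp]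
    rintro hi rfl
    exact hzA hi
  simp [layerFun, this, hA]

theorem stmt1 (n : ℕ) (hn : 1 ≤ n) :
    2 ^ ((n - 1).choose ((n - 1) / 2)) ≤
      Nat.card {φ : CubeOrientation n //
        IsUSO φ ∧ IsAcyclic φ ∧ LocallyUniform φ ∧ StronglyHoltKlee φ} := by
  set z : Fin n := ⟨0, hn⟩
  set h := (n - 1) / 2
  set L := (Finset.univ.erase z).powersetCard h with hL
  have hmem : ∀ A ∈ L, z ∉ A ∧ A.card = h := by
    intro A hA
    rw [hL, Finset.mem_powersetCard] at hA
    exact ⟨fun hz => Finset.notMem_erase z _ (hA.1 hz), hA.2⟩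
  have hcard : Nat.card L.powerset = 2 ^ ((n - 1).choose h) := by
    rw [Nat.card_eq_fintype_card, Fintype.card_coe, Finset.card_powerset, hL,
      Finset.card_powersetCard, Finset.card_erase_of_mem (Finset.mem_univ z), Finset.card_univ,
      Fintype.card_fin]
  rw [← hcard]
  have hmono : ∀ S : L.powerset, ∀ v w : Vertex n, (∀ i, i ≠ z → v i = true → w i = true) →
      layerFun z h S v = true → layerFun z h S w = true := fun S =>
    layerFun_mono fun A hA => (hmem A (Finset.mem_powerset.1 S.2 hA)).2
  have hun := fun S => unate_of_monotone (hmono S)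
  refine Nat.card_le_card_of_injective
    (fun S : L.powerset => ⟨twist z (fun _ => true) (layerFun z h S),
      isUSO_twist _ (hun S), isAcyclic_of_rank (fun _ _ => twistRank_lt (hun S)),
      locallyUniform_twist (hmono S), stronglyHoltKlee_twist _ (hun S)⟩) ?_
  intro S T hST
  have hST := congrArg Subtype.val hST
  have hlay : ∀ v, layerFun z h S v = layerFun z h T v := by
    intro v
    have := congrFun (congrFun hST v) z
    simpa [twist] using this
  apply Subtype.ext
  ext A
  by_cases hA : A ∈ L
  · have := hlay fun i => decide (i ∈ A)
    rw [layerFun_indicator (hmem A hA).1 (hmem A hA).2,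
      layerFun_indicator (hmem A hA).1 (hmem A hA).2] at this
    simpa using this
  · exact ⟨fun h => absurd (Finset.mem_powerset.1 S.2 h) hA,
      fun h => absurd (Finset.mem_powerset.1 T.2 h) hA⟩
end

section
/- There exist a constant c > 0 and N such that for all n ≥ N, the number of distinct orientations of the n-cube that arise as the orientation induced by LCP(M,q) for some n×n K-matrix M and some nondegenerate vector q ∈ ℝ^n (the K-USOs) is at least 2^{c·n³}. -/
open Matrix BigOperators

/-- The K-matrix `1 - N` associated with a strictly lower triangular `N ≥ 0`. -/
theorem isKMatrix_one_sub {n : ℕ} (N : Matrix (Fin n) (Fin n) ℝ)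
    (hN : ∀ i s, i ≤ s → N i s = 0) (hpos : ∀ i s, 0 ≤ N i s) : IsKMatrix (1 - N) := by
  refine ⟨fun i j hij => ?_, fun S _ => ?_⟩
  · simpa [Matrix.one_apply_ne hij] using hpos i j
  · rw [Matrix.det_of_isLowerTriangular]
    · exact Finset.prod_pos fun i _ => by simp [hN _ _ le_rfl]
    · intro i j hij
      have hlt : (i : Fin n) < j := hij
      simp [hN _ _ hlt.le, Matrix.one_apply_ne hlt.ne]

/-- For `M = 1 - N` with `N` strictly lower triangular, `A_B⁻¹ q` is, up to the signs on `B`,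
the solution of the recursion `y = q + N (y restricted to B)`. -/
theorem lcpVal_one_sub {n : ℕ} (N : Matrix (Fin n) (Fin n) ℝ)
    (hN : ∀ i s, i ≤ s → N i s = 0) (q y : Fin n → ℝ) (B : Finset (Fin n))
    (hy : ∀ i, y i = q i + ∑ s ∈ B, N i s * y s) :
    lcpVal (1 - N) q B = fun i => if i ∈ B then -y i else y i := by
  have hdet : IsUnit (ABmat (1 - N) B).det := by
    rw [Matrix.det_of_isLowerTriangular]
    · rw [isUnit_iff_ne_zero, Finset.prod_ne_zero_iff]
      intro i _
      by_cases hi : i ∈ B <;> simp [ABmat, hi, hN _ _ le_rfl]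
    · intro i j hij
      have hlt : i < j := hij
      simp [ABmat, hN _ _ hlt.le, Matrix.one_apply_ne hlt.ne, hlt.ne]
  have hmul : ABmat (1 - N) B *ᵥ (fun i => if i ∈ B then -y i else y i) = q := by
    funext i
    have hterm : ∀ s, ABmat (1 - N) B i s * (if s ∈ B then -y s else y s)
        = (if i = s then y s else 0) - (if s ∈ B then N i s * y s else 0) := by
      intro s
      by_cases hs : s ∈ B <;> by_cases his : i = s <;>
        simp [ABmat, hs, his, sub_mul]
    simp only [Matrix.mulVec, dotProduct, hterm, Finset.sum_sub_distrib]
    have := hy i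
    simp only [Finset.sum_ite_eq, Finset.mem_univ, if_true, Finset.sum_ite_mem,
      Finset.univ_inter]
    linarith
  rw [lcpVal, ← hmul, Matrix.mulVec_mulVec, Matrix.nonsing_inv_mul _ hdet, Matrix.one_mulVec]

/-- A three-layer weight matrix: the layers are `[0, m)`, `[m, 2m)` and `[2m, ∞)`. -/
def layerWeight (m : ℕ) (J : ℕ → ℕ → ℕ) (i s : ℕ) : ℚ :=
  if i < m then 0
  else if i < 2 * m then (if s < m then 1 else 0)
  else if m ≤ s ∧ s < 2 * m then 2 / (2 * J i s + 1) else 0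

/-- The right-hand side for the three-layer construction. -/
noncomputable def layerRhs (m : ℕ) (r : ℝ) (i : ℕ) : ℝ :=
  if i < m then 2 ^ i else if i < 2 * m then 1 else -r

/-- The common value of the recursion on the middle layer. -/
def middleValue {n : ℕ} (m : ℕ) (B : Finset (Fin n)) : ℚ :=
  1 + ∑ s ∈ B, if s.val < m then 2 ^ s.val else 0

/-- The weighted sum received by a coordinate of the last layer. -/
def lastSum {n : ℕ} (m : ℕ) (J : ℕ → ℕ → ℕ) (B : Finset (Fin n)) (i : ℕ) : ℚ :=
  ∑ s ∈ B, if m ≤ s.val ∧ s.val < 2 * m then 2 / (2 * J i s + 1) * middleValue m B else 0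

/-- The solution of the recursion for the three-layer construction. -/
noncomputable def layerValue {n : ℕ} (m : ℕ) (r : ℝ) (J : ℕ → ℕ → ℕ) (B : Finset (Fin n))
    (i : ℕ) : ℝ :=
  if i < m then 2 ^ i else if i < 2 * m then (middleValue m B : ℝ)
  else -r + (lastSum m J B i : ℝ)

/-- `layerWeight` as a real matrix. -/
noncomputable def layerMatrix (n m : ℕ) (J : ℕ → ℕ → ℕ) : Matrix (Fin n) (Fin n) ℝ :=
  fun i s => (layerWeight m J i s : ℝ)

theorem layerMatrix_eq_zero {n m : ℕ} (J : ℕ → ℕ → ℕ) (i s : Fin n) (h : i ≤ s) :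
    layerMatrix n m J i s = 0 := by
  have h' : i.val ≤ s.val := h
  unfold layerMatrix layerWeight
  split_ifs <;> first | omega | simp

theorem layerMatrix_nonneg {n m : ℕ} (J : ℕ → ℕ → ℕ) (i s : Fin n) :
    0 ≤ layerMatrix n m J i s := by
  unfold layerMatrix
  rw [Rat.cast_nonneg]
  unfold layerWeight
  split_ifs <;> positivity

theorem middleValue_pos {n m : ℕ} (B : Finset (Fin n)) : 0 < middleValue m B := by
  unfold middleValue
  have : (0 : ℚ) ≤ ∑ s ∈ B, if s.val < m then 2 ^ s.val else 0 :=
    Finset.sum_nonneg fun s _ => by split_ifs <;> positivity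
  linarith

theorem layerValue_eq {n m : ℕ} (r : ℝ) (J : ℕ → ℕ → ℕ) (B : Finset (Fin n)) (i : Fin n) :
    layerValue m r J B i
      = layerRhs m r i + ∑ s ∈ B, layerMatrix n m J i s * layerValue m r J B s := by
  by_cases h1 : i.val < m
  · simp [layerValue, layerRhs, layerMatrix, layerWeight, h1]
  by_cases h2 : i.val < 2 * m
  · simp only [layerValue, layerRhs, layerMatrix, layerWeight, h1, h2, if_true, if_false,
      middleValue]
    push_cast
    congr 1
    refine Finset.sum_congr rfl fun s _ => ?_
    split_ifs <;> simp
  · simp only [layerValue, layerRhs, layerMatrix, layerWeight, h1, h2, if_false, lastSum]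
    push_cast
    congr 1
    refine Finset.sum_congr rfl fun s _ => ?_
    by_cases hs : m ≤ s.val ∧ s.val < 2 * m
    · simp [hs, not_lt.mpr hs.1]
    · simp [hs]

theorem lcpVal_layer {n m : ℕ} (r : ℝ) (J : ℕ → ℕ → ℕ) (B : Finset (Fin n)) :
    lcpVal (1 - layerMatrix n m J) (fun i => layerRhs m r i) B
      = fun i : Fin n => if i ∈ B then -layerValue m r J B i else layerValue m r J B i :=
  lcpVal_one_sub _ (layerMatrix_eq_zero J) _ _ B (layerValue_eq r J B)

theorem layerValue_ne_zero {n m : ℕ} {r : ℝ} (hr : Irrational r) (J : ℕ → ℕ → ℕ)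
    (B : Finset (Fin n)) (i : ℕ) : layerValue m r J B i ≠ 0 := by
  unfold layerValue
  split_ifs
  · positivity
  · exact_mod_cast (middleValue_pos B).ne'
  · intro h
    exact hr ⟨lastSum m J B i, by linarith⟩

/-- The orientation produced by the three-layer construction. -/
noncomputable def layerOrientation (n m : ℕ) (r : ℝ) (J : ℕ → ℕ → ℕ) : CubeOrientation n :=
  inducedOrientation (1 - layerMatrix n m J) (fun i => layerRhs m r i)

theorem isKUSO_layerOrientation {n m : ℕ} {r : ℝ} (hr : Irrational r) (J : ℕ → ℕ → ℕ) :
    IsKUSO (layerOrientation n m r J) := by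
  refine ⟨_, _, isKMatrix_one_sub _ (layerMatrix_eq_zero J) (layerMatrix_nonneg J), ?_, rfl⟩
  intro B i
  rw [lcpVal_layer]
  dsimp only
  split_ifs
  · exact neg_ne_zero.mpr (layerValue_ne_zero hr J B i)
  · exact layerValue_ne_zero hr J B i

theorem sum_filter_val_mem {n : ℕ} {T : Finset ℕ} (hT : ∀ t ∈ T, t < n) (f : ℕ → ℚ) :
    ∑ s ∈ Finset.univ.filter (fun s : Fin n => s.val ∈ T), f s.val = ∑ t ∈ T, f t := by
  rw [Finset.sum_filter, Fin.sum_univ_eq_sum_range (fun t => if t ∈ T then f t else 0) n,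
    ← Finset.sum_filter]
  congr 1
  ext t
  simpa using hT t

/-- The set consisting of the middle coordinate `b` and the binary expansion of `k`. -/
theorem exists_probe {n m b k : ℕ} (hk : k < 2 ^ m) (hmb : m ≤ b) (hb : b < 2 * m)
    (hn : 2 * m ≤ n) :
    ∃ B : Finset (Fin n), (∀ s ∈ B, s.val < 2 * m) ∧
      ∀ J i, lastSum m J B i = 2 / (2 * J i b + 1) * (1 + k) := by
  have hbit : ∀ t ∈ k.bitIndices.toFinset, t < m := fun t ht =>
    (Nat.pow_lt_pow_iff_right (by norm_num : 1 < 2)).mp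
      ((Nat.two_pow_le_of_mem_bitIndices (List.mem_toFinset.mp ht)).trans_lt hk)
  have hb' : b ∉ k.bitIndices.toFinset := fun h => absurd (hbit b h) (not_lt.mpr hmb)
  have hT : ∀ t ∈ insert b k.bitIndices.toFinset, t < 2 * m := by
    intro t ht
    rcases Finset.mem_insert.mp ht with rfl | ht
    · exact hb
    · have := hbit t ht
      omega
  have hTn : ∀ t ∈ insert b k.bitIndices.toFinset, t < n := fun t ht => (hT t ht).trans_le hn
  refine ⟨Finset.univ.filter fun s => s.val ∈ insert b k.bitIndices.toFinset,
    fun s hs => hT _ (Finset.mem_filter.mp hs).2, fun J i => ?_⟩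
  have hmid : middleValue m
      (Finset.univ.filter fun s : Fin n => s.val ∈ insert b k.bitIndices.toFinset)
      = 1 + k := by
    rw [middleValue, sum_filter_val_mem hTn (fun t => if t < m then 2 ^ t else 0),
      Finset.sum_insert hb', if_neg (not_lt.mpr hmb), zero_add,
      Finset.sum_congr rfl fun t ht => if_pos (hbit t ht)]
    congr 1
    exact_mod_cast Finset.sum_toFinset_bitIndices_two_pow k
  rw [lastSum, hmid, sum_filter_val_mem hTn
    (fun t => if m ≤ t ∧ t < 2 * m then 2 / (2 * (J i t : ℚ) + 1) * (1 + k) else 0),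
    Finset.sum_insert hb', if_pos ⟨hmb, hb⟩,
    Finset.sum_eq_zero fun t ht => if_neg fun h => absurd (hbit t ht) (not_lt.mpr h.1), add_zero]

theorem layerOrientation_ne {n m : ℕ} {r : ℝ} (hr1 : 1 < r) (hr2 : r < 1 + 1 / 2 ^ (m + 1))
    {J J' : ℕ → ℕ → ℕ} {b c : ℕ} (hmb : m ≤ b) (hb : b < 2 * m) (hc : 2 * m ≤ c) (hcn : c < n)
    (hJ : J c b < 2 ^ m) (hlt : J c b < J' c b) :
    layerOrientation n m r J ≠ layerOrientation n m r J' := by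
  intro heq
  obtain ⟨B, hB, hsum⟩ := exists_probe (n := n) hJ hmb hb (hc.trans hcn.le)
  have hcB : (⟨c, hcn⟩ : Fin n) ∉ B := fun h => absurd (hB _ h) (not_lt.mpr hc)
  have hbasis : vertexBasis (fun i => decide (i ∈ B)) = B := by
    ext i
    simp [vertexBasis]
  have hval : ∀ K : ℕ → ℕ → ℕ, layerOrientation n m r K (fun i => decide (i ∈ B)) ⟨c, hcn⟩
      = decide (-r + 2 / (2 * (K c b : ℝ) + 1) * (1 + (J c b : ℝ)) < 0) := by
    intro K
    rw [layerOrientation, inducedOrientation, hbasis, lcpVal_layer, decide_eq_decide]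
    dsimp only
    rw [if_neg hcB, layerValue, if_neg (by omega), if_neg (by omega), hsum]
    push_cast
    rfl
  have hfun := congrFun (congrFun heq fun i => decide (i ∈ B)) ⟨c, hcn⟩
  rw [hval, hval, decide_eq_decide] at hfun
  have hneg : -r + 2 / (2 * (J' c b : ℝ) + 1) * (1 + (J c b : ℝ)) < 0 := by
    have h1 : (J c b : ℝ) + 1 ≤ J' c b := by exact_mod_cast hlt
    have h2 : 2 / (2 * (J' c b : ℝ) + 1) * (1 + (J c b : ℝ)) ≤ 1 := by
      rw [div_mul_eq_mul_div, div_le_one (by positivity)]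
      linarith
    linarith
  have hnonneg : 0 ≤ -r + 2 / (2 * (J c b : ℝ) + 1) * (1 + (J c b : ℝ)) := by
    have h1 : (J c b : ℝ) + 1 ≤ 2 ^ m := by exact_mod_cast hJ
    have h2 : 1 / (2 : ℝ) ^ (m + 1) ≤ 1 / (2 * (J c b : ℝ) + 1) := by
      apply one_div_le_one_div_of_le (by positivity)
      rw [pow_succ]
      linarith
    have h3 : 2 / (2 * (J c b : ℝ) + 1) * (1 + (J c b : ℝ)) = 1 + 1 / (2 * (J c b : ℝ) + 1) := by
      field_simp
      ring
    linarith
  exact absurd (hfun.mpr hneg) (not_lt.mpr hnonneg)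

/-- Parameters on a finite grid, extended by zero to the weights from the middle layer to the
last one. -/
def gridParam {m : ℕ} (F : Fin m → Fin m → Fin (2 ^ m)) (i s : ℕ) : ℕ :=
  if h : i - 2 * m < m ∧ s - m < m then F ⟨i - 2 * m, h.1⟩ ⟨s - m, h.2⟩ else 0

theorem gridParam_apply {m : ℕ} (F : Fin m → Fin m → Fin (2 ^ m)) (c b : Fin m) :
    gridParam F (2 * m + c) (m + b) = F c b := by
  simp [gridParam]

theorem layerOrientation_gridParam_injective {n m : ℕ} (hn : 3 * m ≤ n) {r : ℝ} (hr1 : 1 < r)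
    (hr2 : r < 1 + 1 / 2 ^ (m + 1)) :
    Function.Injective fun F : Fin m → Fin m → Fin (2 ^ m) =>
      layerOrientation n m r (gridParam F) := by
  have key : ∀ (F G : Fin m → Fin m → Fin (2 ^ m)) (c b : Fin m), F c b < G c b →
      layerOrientation n m r (gridParam F) ≠ layerOrientation n m r (gridParam G) := by
    intro F G c b h
    have hc := c.isLt
    have hb := b.isLt
    refine layerOrientation_ne (b := m + b) (c := 2 * m + c) hr1 hr2 (by omega) (by omega)
      (by omega) (by omega) ?_ ?_
    · rw [gridParam_apply]
      exact (F c b).isLt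
    · rw [gridParam_apply, gridParam_apply]
      exact h
  intro F G hFG
  funext c b
  rcases lt_trichotomy (F c b) (G c b) with h | h | h
  · exact absurd hFG (key F G c b h)
  · exact h
  · exact absurd hFG.symm (key G F c b h)

theorem two_pow_le_card_isKUSO {n m : ℕ} (hn : 3 * m ≤ n) :
    2 ^ (m ^ 3) ≤ Nat.card {φ : CubeOrientation n // IsKUSO φ} := by
  obtain ⟨r, hr, hr1, hr2⟩ := exists_irrational_btwn
    (show (1 : ℝ) < 1 + 1 / 2 ^ (m + 1) by simp)
  have hcard : Nat.card (Fin m → Fin m → Fin (2 ^ m)) = 2 ^ (m ^ 3) := by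
    simp only [Nat.card_eq_fintype_card, Fintype.card_pi, Fintype.card_fin, Finset.prod_const,
      Finset.card_univ, ← pow_mul]
    congr 1
    ring
  rw [← hcard]
  exact Nat.card_le_card_of_injective
    (fun F => ⟨layerOrientation n m r (gridParam F), isKUSO_layerOrientation hr _⟩)
    fun F G h => layerOrientation_gridParam_injective hn hr1 hr2 (congrArg Subtype.val h)

theorem stmt2 : ∃ c : ℝ, 0 < c ∧ ∃ N : ℕ, ∀ n : ℕ, N ≤ n →
    (2 : ℝ) ^ (c * (n : ℝ) ^ 3) ≤ (Nat.card {φ : CubeOrientation n // IsKUSO φ} : ℝ) := by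
  refine ⟨1 / 125, by norm_num, 3, fun n hn => ?_⟩
  have hm : (n : ℝ) ≤ 5 * (n / 3 : ℕ) := by
    exact_mod_cast (by omega : n ≤ 5 * (n / 3))
  have hexp : 1 / 125 * (n : ℝ) ^ 3 ≤ (((n / 3) ^ 3 : ℕ) : ℝ) := by
    have := pow_le_pow_left₀ (Nat.cast_nonneg n) hm 3
    rw [mul_pow] at this
    push_cast at this ⊢
    linarith
  calc (2 : ℝ) ^ (1 / 125 * (n : ℝ) ^ 3)
      ≤ 2 ^ (((n / 3) ^ 3 : ℕ) : ℝ) := Real.rpow_le_rpow_of_exponent_le one_le_two hexp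
    _ = ((2 ^ ((n / 3) ^ 3) : ℕ) : ℝ) := by
        rw [Real.rpow_natCast]
        push_cast
        rfl
    _ ≤ _ := by exact_mod_cast two_pow_le_card_isKUSO (Nat.mul_div_le n 3)
end

section
/- There exists a constant c such that for every n ≥ 1 and every n×n P-matrix M, the number of distinct orientations of the n-cube induced by LCP(M,q), as q ranges over all vectors nondegenerate for M, is at most 2^{c·n²}; that is, u(M) = 2^{O(n²)} uniformly over all n×n P-matrices M. -/
open Matrix BigOperators

/-- A set of linear functionals that is shattered by strict sign patterns is linearly
independent. -/
lemma linearIndepOn_of_shatters_signs {ι V : Type*} [DecidableEq ι] [AddCommGroup V]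
    [Module ℝ V] (f : ι → Module.Dual ℝ V) {𝒜 : Finset (Finset ι)}
    (h𝒜 : ∀ s ∈ 𝒜, ∃ q, ∀ k, f k q ≠ 0 ∧ (k ∈ s ↔ f k q < 0))
    {s : Finset ι} (hs : 𝒜.Shatters s) : LinearIndepOn ℝ f (s : Set ι) := by
  rw [linearIndepOn_finset_iff]
  intro a ha
  obtain ⟨u, hu, hsu⟩ := hs (Finset.filter_subset (fun k => 0 < a k) s)
  obtain ⟨q, hq⟩ := h𝒜 u hu
  have hmem : ∀ k ∈ s, (f k q < 0 ↔ 0 < a k) := fun k hk => by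
    have := congrArg (k ∈ ·) hsu
    simpa [hk, (hq k).2] using this
  have hterm : ∀ k ∈ s, a k * f k q ≤ 0 := fun k hk => by
    rcases lt_or_ge 0 (a k) with hpos | hneg
    · exact mul_nonpos_of_nonneg_of_nonpos hpos.le ((hmem k hk).2 hpos).le
    · exact mul_nonpos_of_nonpos_of_nonneg hneg
        (not_lt.1 fun hlt => hneg.not_gt ((hmem k hk).1 hlt))
  have hsum : ∑ k ∈ s, a k * f k q = 0 := by
    simpa using congrArg (fun g : Module.Dual ℝ V => g q) ha
  intro k hk
  exact (mul_eq_zero.1 ((Finset.sum_eq_zero_iff_of_nonpos hterm).1 hsum k hk)).resolve_right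
    (hq k).1

lemma sum_choose_le_succ_pow (N d : ℕ) : ∑ k ∈ Finset.Iic d, N.choose k ≤ (N + 1) ^ d := by
  rw [add_pow, ← Nat.range_succ_eq_Iic]
  refine Finset.sum_le_sum fun k hk => ?_
  have hkd : k ≤ d := Nat.lt_succ_iff.1 (Finset.mem_range.1 hk)
  simpa using (Nat.choose_le_pow N k).trans
    (Nat.le_mul_of_pos_right (N ^ k) (Nat.choose_pos hkd))

/-- The number of strict sign patterns of `N` linear functionals on a space of dimension `d`
is at most `(N + 1) ^ d`. -/
lemma card_signs_le {ι V : Type*} [Fintype ι] [DecidableEq ι] [AddCommGroup V]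
    [Module ℝ V] [FiniteDimensional ℝ V] (f : ι → Module.Dual ℝ V) {𝒜 : Finset (Finset ι)}
    (h𝒜 : ∀ s ∈ 𝒜, ∃ q, ∀ k, f k q ≠ 0 ∧ (k ∈ s ↔ f k q < 0)) :
    𝒜.card ≤ (Fintype.card ι + 1) ^ Module.finrank ℝ V := by
  have hvc : 𝒜.vcDim ≤ Module.finrank ℝ V := by
    refine Finset.sup_le fun s hs => ?_
    have hli := linearIndepOn_of_shatters_signs f h𝒜 (Finset.mem_shatterer.1 hs)
    simpa [Subspace.dual_finrank_eq] using LinearIndependent.fintype_card_le_finrank hli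
  calc 𝒜.card ≤ 𝒜.shatterer.card := 𝒜.card_le_card_shatterer
    _ ≤ ∑ k ∈ Finset.Iic 𝒜.vcDim, (Fintype.card ι).choose k :=
      Finset.card_shatterer_le_sum_vcDim
    _ ≤ (Fintype.card ι + 1) ^ 𝒜.vcDim := sum_choose_le_succ_pow _ _
    _ ≤ (Fintype.card ι + 1) ^ Module.finrank ℝ V := Nat.pow_le_pow_right (Nat.succ_pos _) hvc

lemma card_inducedOrientation_le {n : ℕ} (M : Matrix (Fin n) (Fin n) ℝ) :
    Nat.card {φ : CubeOrientation n //
        ∃ q : Fin n → ℝ, Nondegenerate M q ∧ φ = inducedOrientation M q} ≤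
      (2 ^ n * n + 1) ^ n := by
  classical
  let outEdges : CubeOrientation n → Finset (Vertex n × Fin n) :=
    fun φ => Finset.univ.filter fun e => φ e.1 e.2 = true
  have hinj : Function.Injective outEdges := fun φ ψ h => by
    funext v i
    have := congrArg ((v, i) ∈ ·) h
    simpa [outEdges, ← Bool.eq_iff_iff] using this
  let f : Vertex n × Fin n → Module.Dual ℝ (Fin n → ℝ) := fun e =>
    LinearMap.proj e.2 ∘ₗ (ABmat M (vertexBasis e.1))⁻¹.mulVecLin
  have hf : ∀ e q, f e q = lcpVal M q (vertexBasis e.1) e.2 := fun _ _ => rfl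
  rw [Nat.card_eq_fintype_card, Fintype.card_subtype, ← Finset.card_image_of_injective _ hinj]
  refine (card_signs_le f ?_).trans_eq (by simp)
  intro s hs
  obtain ⟨φ, hφ, rfl⟩ := Finset.mem_image.1 hs
  obtain ⟨q, hq, rfl⟩ := (Finset.mem_filter.1 hφ).2
  exact ⟨q, fun e => ⟨hq _ _, by simp [outEdges, inducedOrientation, hf]⟩⟩

theorem stmt4 : ∃ c : ℝ, ∀ n : ℕ, 1 ≤ n → ∀ M : Matrix (Fin n) (Fin n) ℝ, IsPMatrix M →
    (Nat.card {φ : CubeOrientation n //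
        ∃ q : Fin n → ℝ, Nondegenerate M q ∧ φ = inducedOrientation M q} : ℝ) ≤
      (2 : ℝ) ^ (c * (n : ℝ) ^ 2) := by
  refine ⟨2, fun n _ M _ => ?_⟩
  have hbase : 2 ^ n * n + 1 ≤ 2 ^ n * 2 ^ n :=
    (Nat.add_le_add_left Nat.one_le_two_pow _).trans
      (Nat.mul_le_mul_left (2 ^ n) (Nat.succ_le_of_lt n.lt_two_pow_self))
  have hpow : (2 ^ n * 2 ^ n) ^ n = 2 ^ (2 * n ^ 2) := by ring
  have hcard := (card_inducedOrientation_le M).trans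
    ((Nat.pow_le_pow_left hbase n).trans_eq hpow)
  calc _ ≤ ((2 ^ (2 * n ^ 2) : ℕ) : ℝ) := Nat.cast_le.2 hcard
    _ = (2 : ℝ) ^ (2 * (n : ℝ) ^ 2) := by
      exact_mod_cast (Real.rpow_natCast 2 (2 * n ^ 2)).symm
end

section
/- There exist a constant c > 0 and N such that for every n ≥ N there is an n×n P-matrix M for which the number of distinct orientations of the n-cube induced by LCP(M,q), as q ranges over all vectors nondegenerate for M, is at least 2^{c·n²}; that is, max_M u(M) = 2^{Ω(n²)}. -/
open Matrix BigOperators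

/-- The unit lower triangular matrix whose off-diagonal nonzero entries are the powers `2 ^ j`
in the columns `j < m` of the rows `i ≥ m`. -/
def binaryMatrix (n m : ℕ) : Matrix (Fin n) (Fin n) ℝ :=
  fun i j => if i = j then 1 else if (j : ℕ) < m ∧ m ≤ (i : ℕ) then 2 ^ (j : ℕ) else 0

theorem binaryMatrix_apply_self {n m : ℕ} (i : Fin n) : binaryMatrix n m i i = 1 := by
  simp [binaryMatrix]

theorem binaryMatrix_apply_of_lt {n m : ℕ} {i j : Fin n} (h : i < j) :
    binaryMatrix n m i j = 0 := by
  have h' : (i : ℕ) < j := h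
  unfold binaryMatrix
  rw [if_neg h.ne, if_neg (by omega)]

theorem isPMatrix_binaryMatrix (n m : ℕ) : IsPMatrix (binaryMatrix n m) := by
  intro S _
  rw [Matrix.det_of_isLowerTriangular]
  · simp [binaryMatrix_apply_self]
  · intro i j hij
    exact binaryMatrix_apply_of_lt hij

theorem isUnit_det_ABmat_binaryMatrix {n m : ℕ} (B : Finset (Fin n)) :
    IsUnit (ABmat (binaryMatrix n m) B).det := by
  rw [Matrix.det_of_isLowerTriangular, isUnit_iff_ne_zero, Finset.prod_ne_zero_iff]
  · intro i _
    by_cases h : i ∈ B <;> simp [ABmat, h, binaryMatrix_apply_self]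
  · intro i j hij
    have hij' : i < j := hij
    by_cases h : j ∈ B <;> simp [ABmat, h, binaryMatrix_apply_of_lt hij', hij'.ne]

/-- The number with binary expansion `{j ∈ B : j < m}` for rows `i ≥ m`, and `0` for rows
`i < m`. -/
def rowShift {n : ℕ} (m : ℕ) (B : Finset (Fin n)) (i : Fin n) : ℕ :=
  ∑ j : Fin n, if j ∈ B ∧ (j : ℕ) < m ∧ m ≤ (i : ℕ) then 2 ^ (j : ℕ) else 0

theorem rowShift_of_lt {n m : ℕ} (B : Finset (Fin n)) {i : Fin n} (h : (i : ℕ) < m) :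
    rowShift m B i = 0 :=
  Finset.sum_eq_zero fun j _ => if_neg (by omega)

theorem lcpVal_binaryMatrix {n m : ℕ} {q : Fin n → ℝ} (hq : ∀ j : Fin n, (j : ℕ) < m → q j = -1)
    (B : Finset (Fin n)) (i : Fin n) :
    lcpVal (binaryMatrix n m) q B i = (if i ∈ B then -1 else 1) * (q i + rowShift m B i) := by
  set x : Fin n → ℝ := fun i => (if i ∈ B then -1 else 1) * (q i + rowShift m B i) with hx
  have hmul : ABmat (binaryMatrix n m) B *ᵥ x = q := by
    funext i
    have hterm : ∀ s, ABmat (binaryMatrix n m) B i s * x s =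
        (if s = i then q i + rowShift m B i else 0) -
          (if s ∈ B ∧ (s : ℕ) < m ∧ m ≤ (i : ℕ) then 2 ^ (s : ℕ) else 0) := by
      intro s
      rcases eq_or_ne s i with rfl | hs
      · have hcond : ¬(s ∈ B ∧ (s : ℕ) < m ∧ m ≤ (s : ℕ)) := by omega
        rw [if_pos rfl, if_neg hcond, sub_zero]
        by_cases hB : s ∈ B <;> simp [ABmat, hB, hx, binaryMatrix_apply_self]
      · by_cases hB : s ∈ B
        · by_cases hm : (s : ℕ) < m ∧ m ≤ (i : ℕ)
          · simp [ABmat, hB, hx, binaryMatrix, hs, hs.symm, hm, hq s hm.1, rowShift_of_lt B hm.1]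
          · simp [ABmat, hB, hs, hs.symm, hm, binaryMatrix]
        · simp [ABmat, hB, hs, hs.symm]
    simp only [Matrix.mulVec, dotProduct, hterm, Finset.sum_sub_distrib]
    simp [rowShift]
  have hinv : lcpVal (binaryMatrix n m) q B = x := by
    unfold lcpVal
    conv_lhs => rw [← hmul]
    rw [Matrix.mulVec_mulVec, Matrix.nonsing_inv_mul _ (isUnit_det_ABmat_binaryMatrix B),
      Matrix.one_mulVec]
  rw [hinv]

/-- Every `t < 2 ^ m` is the row shift of a set of coordinates below `m`. -/
theorem exists_rowShift_eq {n m t : ℕ} (hmn : m ≤ n) (ht : t < 2 ^ m) :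
    ∃ v : Vertex n, ∀ i : Fin n, m ≤ (i : ℕ) →
      i ∉ vertexBasis v ∧ rowShift m (vertexBasis v) i = t := by
  have hbit : ∀ j ∈ t.bitIndices.toFinset, j < m := fun j hj =>
    (Nat.pow_lt_pow_iff_right one_lt_two).1
      ((Nat.two_pow_le_of_mem_bitIndices (List.mem_toFinset.1 hj)).trans_lt ht)
  refine ⟨fun j => decide ((j : ℕ) ∈ t.bitIndices.toFinset), fun i hi => ⟨?_, ?_⟩⟩
  · simp only [vertexBasis, Finset.mem_filter, Finset.mem_univ, true_and, decide_eq_true_eq]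
    exact fun h => (hbit _ h).not_ge hi
  · have hsum : rowShift m (vertexBasis fun j : Fin n =>
        decide ((j : ℕ) ∈ t.bitIndices.toFinset)) i =
        ∑ j : Fin n, if (j : ℕ) ∈ t.bitIndices.toFinset then 2 ^ (j : ℕ) else 0 := by
      refine Finset.sum_congr rfl fun j _ => if_congr ?_ rfl rfl
      simp only [vertexBasis, Finset.mem_filter, Finset.mem_univ, true_and, decide_eq_true_eq]
      exact ⟨fun h => h.1, fun h => ⟨h, hbit _ h, hi⟩⟩
    rw [hsum, Fin.sum_univ_eq_sum_range
      (fun j => if j ∈ t.bitIndices.toFinset then 2 ^ j else 0) n, ← Finset.sum_filter,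
      Finset.filter_mem_eq_inter, Finset.inter_eq_right.2
        fun j hj => Finset.mem_range.2 ((hbit j hj).trans_le hmn)]
    exact Finset.sum_toFinset_bitIndices_two_pow t

/-- The vector equal to `-1` on the coordinates below `m`, and to `1 / 2 - k` on the others. -/
noncomputable def thresholdVector {n m : ℕ} (k : Fin (n - m) → Fin (2 ^ m)) (i : Fin n) : ℝ :=
  if h : (i : ℕ) < m then -1 else 1 / 2 - ((k ⟨i - m, by omega⟩ : ℕ) : ℝ)

theorem thresholdVector_of_lt {n m : ℕ} (k : Fin (n - m) → Fin (2 ^ m)) (i : Fin n)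
    (h : (i : ℕ) < m) : thresholdVector k i = -1 :=
  dif_pos h

theorem nondegenerate_thresholdVector {n m : ℕ} (k : Fin (n - m) → Fin (2 ^ m)) :
    Nondegenerate (binaryMatrix n m) (thresholdVector k) := by
  intro B i
  rw [lcpVal_binaryMatrix (thresholdVector_of_lt k)]
  refine mul_ne_zero (by split_ifs <;> norm_num) ?_
  by_cases h : (i : ℕ) < m
  · simp [thresholdVector_of_lt k i h, rowShift_of_lt B h]
  · rw [thresholdVector, dif_neg h]
    intro h0
    have h1 : ((1 + 2 * rowShift m B i : ℕ) : ℝ) = ((2 * (k ⟨i - m, by omega⟩ : ℕ) : ℕ) : ℝ) := by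
      push_cast
      linarith
    have h2 := Nat.cast_injective h1
    omega

theorem exists_inducedOrientation_eq_decide {n m t : ℕ} (hmn : m ≤ n) (ht : t < 2 ^ m) :
    ∃ v : Vertex n, ∀ (k : Fin (n - m) → Fin (2 ^ m)) (a : Fin (n - m)),
      inducedOrientation (binaryMatrix n m) (thresholdVector k) v ⟨a + m, by omega⟩ =
        decide (t < (k a : ℕ)) := by
  obtain ⟨v, hv⟩ := exists_rowShift_eq hmn ht
  refine ⟨v, fun k a => ?_⟩
  obtain ⟨hmem, hshift⟩ := hv ⟨a + m, by omega⟩ (Nat.le_add_left _ _)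
  rw [inducedOrientation, decide_eq_decide, lcpVal_binaryMatrix (thresholdVector_of_lt k),
    if_neg hmem, hshift, thresholdVector, dif_neg (by simp)]
  simp only [Nat.add_sub_cancel, Fin.eta]
  constructor
  · intro h
    have : (t : ℝ) < (k a : ℕ) := by linarith
    exact_mod_cast this
  · intro h
    have : ((t + 1 : ℕ) : ℝ) ≤ (k a : ℕ) := by exact_mod_cast h
    push_cast at this
    linarith

theorem injective_inducedOrientation_thresholdVector {n m : ℕ} (hmn : m ≤ n) :
    Function.Injective fun k : Fin (n - m) → Fin (2 ^ m) =>
      inducedOrientation (binaryMatrix n m) (thresholdVector k) := by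
  intro k k' h
  have key : ∀ a t, t < 2 ^ m → (t < (k a : ℕ) ↔ t < (k' a : ℕ)) := by
    intro a t ht
    obtain ⟨v, hv⟩ := exists_inducedOrientation_eq_decide hmn ht
    rw [← decide_eq_decide, ← hv k a, ← hv k' a]
    exact congrFun (congrFun h v) _
  funext a
  have h1 := key a _ (k a).2
  have h2 := key a _ (k' a).2
  exact Fin.ext (by omega)

theorem two_pow_le_card_inducedOrientation {n m : ℕ} (hmn : m ≤ n) :
    2 ^ (m * (n - m)) ≤ Nat.card {φ : CubeOrientation n //
      ∃ q : Fin n → ℝ, Nondegenerate (binaryMatrix n m) q ∧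
        φ = inducedOrientation (binaryMatrix n m) q} := by
  have h := Nat.card_le_card_of_injective
    (fun k : Fin (n - m) → Fin (2 ^ m) =>
      (⟨_, thresholdVector k, nondegenerate_thresholdVector k, rfl⟩ :
        {φ : CubeOrientation n // ∃ q : Fin n → ℝ, Nondegenerate (binaryMatrix n m) q ∧
          φ = inducedOrientation (binaryMatrix n m) q}))
    fun k k' hk => injective_inducedOrientation_thresholdVector hmn (congrArg Subtype.val hk)
  simpa [pow_mul] using h

theorem stmt5 : ∃ c : ℝ, 0 < c ∧ ∃ N : ℕ, ∀ n : ℕ, N ≤ n →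
    ∃ M : Matrix (Fin n) (Fin n) ℝ, IsPMatrix M ∧
      (2 : ℝ) ^ (c * (n : ℝ) ^ 2) ≤
        (Nat.card {φ : CubeOrientation n //
          ∃ q : Fin n → ℝ, Nondegenerate M q ∧ φ = inducedOrientation M q} : ℝ) := by
  refine ⟨1 / 8, by norm_num, 2, fun n hn => ⟨binaryMatrix n (n / 2),
    isPMatrix_binaryMatrix n _, ?_⟩⟩
  have hle : n / 2 ≤ n := Nat.div_le_self n 2
  refine le_trans ?_ (Nat.cast_le.2 (two_pow_le_card_inducedOrientation hle))
  rw [Nat.cast_pow, Nat.cast_ofNat, ← Real.rpow_natCast 2 (n / 2 * _)]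
  refine Real.rpow_le_rpow_of_exponent_le one_le_two ?_
  have h1 : (n : ℝ) ≤ 4 * (n / 2 : ℕ) := by
    exact_mod_cast (by omega : n ≤ 4 * (n / 2))
  have h2 : (n : ℝ) ≤ 2 * (n - n / 2 : ℕ) := by
    exact_mod_cast (by omega : n ≤ 2 * (n - n / 2))
  rw [Nat.cast_mul]
  nlinarith [mul_le_mul h1 h2 (Nat.cast_nonneg n) (by positivity)]
end
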